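/- Every generalized series-parallel graph G is strongly efficient for every placement of the terminal pairs (s_1,t_1),(s_2,t_2): for every nonnegative cost function, every optimal Steiner forest of the induced two-player network design game is enforceable. -/

import Mathlib

namespace NDG

variable {V : Type*} [DecidableEq V]

/-- Total cost of a finite set of edges. -/
def cost (c : Sym2 V → ℝ) (F : Finset (Sym2 V)) : ℝ := ∑ e ∈ F, c e

/-- A Steiner forest: an acyclic set of edges of `G` connecting both
terminal pairs. -/
def IsSteinerForest (G : SimpleGraph V) (s₁ t₁ s₂ t₂ : V) (F : Finset (Sym2 V)) : Prop :=
  (↑F ⊆ G.edgeSet) ∧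
  (SimpleGraph.fromEdgeSet (↑F : Set (Sym2 V))).IsAcyclic ∧
  (∃ p : G.Walk s₁ t₁, p.IsPath ∧ ∀ e ∈ p.edges, e ∈ F) ∧
  (∃ p : G.Walk s₂ t₂, p.IsPath ∧ ∀ e ∈ p.edges, e ∈ F)

/-- An optimal Steiner forest: one of minimum total cost. -/
def IsOptimalSteinerForest (G : SimpleGraph V) (s₁ t₁ s₂ t₂ : V) (c : Sym2 V → ℝ)
    (F : Finset (Sym2 V)) : Prop :=
  IsSteinerForest G s₁ t₁ s₂ t₂ F ∧
  ∀ F', IsSteinerForest G s₁ t₁ s₂ t₂ F' → cost c F ≤ cost c F'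

/-- A strategy of a player: a simple path between her terminals. -/
abbrev Strat (G : SimpleGraph V) (s t : V) := {p : G.Walk s t // p.IsPath}

/-- A cost sharing protocol: cost shares for both players on every edge,
depending on the chosen strategy profile. -/
abbrev Protocol (G : SimpleGraph V) (s₁ t₁ s₂ t₂ : V) :=
  Strat G s₁ t₁ → Strat G s₂ t₂ → Fin 2 → Sym2 V → ℝ

/-- The set of players using edge `e` in the profile `(P₁, P₂)`. -/
def usedBy {G : SimpleGraph V} {s₁ t₁ s₂ t₂ : V}
    (P₁ : Strat G s₁ t₁) (P₂ : Strat G s₂ t₂) (e : Sym2 V) : Finset (Fin 2) :=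
  (if e ∈ P₁.1.edges then {0} else ∅) ∪ (if e ∈ P₂.1.edges then {1} else ∅)

/-- The total cost player 1 pays. -/
def cost₁ {G : SimpleGraph V} {s₁ t₁ s₂ t₂ : V} (Ξ : Protocol G s₁ t₁ s₂ t₂)
    (P₁ : Strat G s₁ t₁) (P₂ : Strat G s₂ t₂) : ℝ :=
  ∑ e ∈ P₁.1.edges.toFinset, Ξ P₁ P₂ 0 e

/-- The total cost player 2 pays. -/
def cost₂ {G : SimpleGraph V} {s₁ t₁ s₂ t₂ : V} (Ξ : Protocol G s₁ t₁ s₂ t₂)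
    (P₁ : Strat G s₁ t₁) (P₂ : Strat G s₂ t₂) : ℝ :=
  ∑ e ∈ P₂.1.edges.toFinset, Ξ P₁ P₂ 1 e

/-- Pure Nash equilibrium of the two-player game induced by the protocol `Ξ`. -/
def IsPNE {G : SimpleGraph V} {s₁ t₁ s₂ t₂ : V} (Ξ : Protocol G s₁ t₁ s₂ t₂)
    (P₁ : Strat G s₁ t₁) (P₂ : Strat G s₂ t₂) : Prop :=
  (∀ Q₁, cost₁ Ξ P₁ P₂ ≤ cost₁ Ξ Q₁ P₂) ∧ (∀ Q₂, cost₂ Ξ P₁ P₂ ≤ cost₂ Ξ P₁ Q₂)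

/-- A separable cost sharing protocol: nonnegative, budget-balanced, stable and
separable (cost shares on an edge depend only on the set of players using it). -/
structure IsSeparable {G : SimpleGraph V} {s₁ t₁ s₂ t₂ : V} (c : Sym2 V → ℝ)
    (Ξ : Protocol G s₁ t₁ s₂ t₂) : Prop where
  nonneg : ∀ P₁ P₂ i e, 0 ≤ Ξ P₁ P₂ i e
  budget : ∀ P₁ P₂ e, (usedBy P₁ P₂ e).Nonempty →
    ∑ i ∈ usedBy P₁ P₂ e, Ξ P₁ P₂ i e = c e
  stable : ∃ P₁ P₂, IsPNE Ξ P₁ P₂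
  separable : ∀ P₁ P₂ Q₁ Q₂ e, usedBy P₁ P₂ e = usedBy Q₁ Q₂ e →
    ∀ i, Ξ P₁ P₂ i e = Ξ Q₁ Q₂ i e

/-- A Steiner forest `F` is enforceable if the profile of the unique paths of
the two players inside `F` is a pure Nash equilibrium of the game induced by
some separable cost sharing protocol. -/
def Enforceable (G : SimpleGraph V) (s₁ t₁ s₂ t₂ : V) (c : Sym2 V → ℝ)
    (F : Finset (Sym2 V)) : Prop :=
  ∃ (P₁ : Strat G s₁ t₁) (P₂ : Strat G s₂ t₂),
    (∀ e ∈ P₁.1.edges, e ∈ F) ∧ (∀ e ∈ P₂.1.edges, e ∈ F) ∧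
    (∀ Q₁ : Strat G s₁ t₁, (∀ e ∈ Q₁.1.edges, e ∈ F) → Q₁ = P₁) ∧
    (∀ Q₂ : Strat G s₂ t₂, (∀ e ∈ Q₂.1.edges, e ∈ F) → Q₂ = P₂) ∧
    ∃ Ξ : Protocol G s₁ t₁ s₂ t₂, IsSeparable c Ξ ∧ IsPNE Ξ P₁ P₂

/-- `(G,(s₁,t₁),(s₂,t₂))` is efficient: for every nonnegative cost function
some optimal Steiner forest is enforceable (the PoS is 1). -/
def Efficient (G : SimpleGraph V) (s₁ t₁ s₂ t₂ : V) : Prop :=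
  ∀ c : Sym2 V → ℝ, (∀ e, 0 ≤ c e) →
    ∃ F, IsOptimalSteinerForest G s₁ t₁ s₂ t₂ c F ∧ Enforceable G s₁ t₁ s₂ t₂ c F

/-- `(G,(s₁,t₁),(s₂,t₂))` is strongly efficient: for every nonnegative cost
function every optimal Steiner forest is enforceable. -/
def StronglyEfficient (G : SimpleGraph V) (s₁ t₁ s₂ t₂ : V) : Prop :=
  ∀ c : Sym2 V → ℝ, (∀ e, 0 ≤ c e) →
    ∀ F, IsOptimalSteinerForest G s₁ t₁ s₂ t₂ c F → Enforceable G s₁ t₁ s₂ t₂ c F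


/-- `H` has a `K₄` minor: there are four nonempty, pairwise disjoint, connected
branch sets which are pairwise joined by an edge of `H`. -/
def HasK4Minor (H : SimpleGraph V) : Prop :=
  ∃ S : Fin 4 → Set V, (∀ i, (S i).Nonempty) ∧
    (∀ i, (H.induce (S i)).Connected) ∧
    (∀ i j, i ≠ j → Disjoint (S i) (S j)) ∧
    (∀ i j, i ≠ j → ∃ p ∈ S i, ∃ q ∈ S j, H.Adj p q)

/-- Upper bounds for the total share of a player. -/
def RR (C : ℕ → ℝ) (α β : ℕ → ℝ → Prop) (γ : ℝ → Prop) (r : ℝ) : Prop :=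
  γ r ∨ ∃ j i ra rb, α j ra ∧ β i rb ∧ r = ra + rb + max 0 (C i - C j)

lemma lp (k : ℕ) (C : ℕ → ℝ) (hC : Monotone C) (hC0 : C 0 = 0)
    (α1 β1 α2 β2 : ℕ → ℝ → Prop) (γ1 γ2 : ℝ → Prop)
    (kb1 : ∀ j r, β1 j r → j ≤ k)
    (ka2 : ∀ j r, α2 j r → j ≤ k)
    (za1 : α1 0 0) (zb1 : β1 k 0) (za2 : α2 0 0) (zb2 : β2 k 0)
    (O1 : ∀ j m r r', α1 j r → α2 m r' → C (min j m) ≤ r + r')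
    (O2 : ∀ j m r r', β1 j r → β2 m r' → C k - C (max j m) ≤ r + r')
    (O3 : ∀ r r', RR C α1 β1 γ1 r → RR C α2 β2 γ2 r' → C k ≤ r + r') :
    ∃ y : ℕ → ℝ, (∀ m n, m ≤ n → 0 ≤ y n - y m ∧ y n - y m ≤ C n - C m) ∧
      (∀ j r, α1 j r → y j - y 0 ≤ r) ∧ (∀ j r, β1 j r → y k - y j ≤ r) ∧
      (∀ r, γ1 r → y k - y 0 ≤ r) ∧
      (∀ j r, α2 j r → (C j - y j) - (C 0 - y 0) ≤ r) ∧
      (∀ j r, β2 j r → (C k - y k) - (C j - y j) ≤ r) ∧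
      (∀ r, γ2 r → (C k - y k) - (C 0 - y 0) ≤ r) := by
  have hCk : 0 ≤ C k := hC0 ▸ hC (Nat.zero_le k)
  have r1 : RR C α1 β1 γ1 (C k) := Or.inr ⟨0, k, 0, 0, za1, zb1, by rw [hC0]; simp [hCk]⟩
  have r2 : RR C α2 β2 γ2 (C k) := Or.inr ⟨0, k, 0, 0, za2, zb2, by rw [hC0]; simp [hCk]⟩
  obtain ⟨Y, hY1, hY2⟩ : ∃ Y, (∀ r, RR C α1 β1 γ1 r → Y ≤ r) ∧
      (∀ r, RR C α2 β2 γ2 r → C k - r ≤ Y) := by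
    refine ⟨sInf {r | RR C α1 β1 γ1 r}, fun r hr => csInf_le ⟨C k - C k, ?_⟩ hr,
      fun r hr => le_csInf ⟨_, r1⟩ ?_⟩
    · intro r' hr'
      linarith [O3 r' _ hr' r2]
    · intro r' hr'
      linarith [O3 r' _ hr' hr]
  have hb1 : ∀ j r, β1 j r → 0 ≤ r := by
    intro j r h
    have := O2 j k r 0 h zb2
    rw [max_eq_right (kb1 j r h)] at this
    linarith
  have ha2 : ∀ j r, α2 j r → 0 ≤ r := by
    intro j r h
    have := O1 0 j 0 r za1 h
    simp [hC0] at this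
    linarith
  let T : ℕ → Set ℝ := fun n => {v | (∃ m r, α2 m r ∧ v = C (min n m) - r) ∨
    (∃ i r, β1 i r ∧ v = Y - r - max 0 (C i - C n))}
  have hne : ∀ n, (T n).Nonempty := fun n => ⟨_, Or.inl ⟨0, 0, za2, rfl⟩⟩
  have hbd : ∀ n, BddAbove (T n) := by
    intro n
    refine ⟨max (C n) Y, ?_⟩
    rintro v (⟨m, r, h, rfl⟩ | ⟨i, r, h, rfl⟩)
    · have := hC (min_le_left n m)
      have := ha2 _ _ h
      have := le_max_left (C n) Y
      linarith
    · have := le_max_right (C n) Y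
      have := le_max_left 0 (C i - C n)
      have := hb1 _ _ h
      linarith
  let y : ℕ → ℝ := fun n => sSup (T n)
  have up : ∀ n b, (∀ m r, α2 m r → C (min n m) - r ≤ b) →
      (∀ i r, β1 i r → Y - r - max 0 (C i - C n) ≤ b) → y n ≤ b := by
    intro n b h1 h2
    refine csSup_le (hne n) ?_
    rintro v (⟨m, r, h, rfl⟩ | ⟨i, r, h, rfl⟩)
    · exact h1 m r h
    · exact h2 i r h
  have lo1 : ∀ n m r, α2 m r → C (min n m) - r ≤ y n := fun n m r h =>
    le_csSup (hbd n) (Or.inl ⟨m, r, h, rfl⟩)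
  have lo2 : ∀ n i r, β1 i r → Y - r - max 0 (C i - C n) ≤ y n := fun n m r h =>
    le_csSup (hbd n) (Or.inr ⟨m, r, h, rfl⟩)
  have y0 : y 0 = 0 := by
    apply le_antisymm
    · apply up
      · intro m r h
        have := ha2 _ _ h
        simp [hC0]; linarith
      · intro i r h
        have := hY1 _ (Or.inr ⟨0, i, 0, r, za1, h, rfl⟩)
        linarith
    · have := lo1 0 0 0 za2
      simpa [hC0] using this
  have yk : y k = Y := by
    apply le_antisymm
    · apply up
      · intro m r h
        have h' := hY2 _ (Or.inr ⟨m, k, r, 0, h, zb2, rfl⟩)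
        have hm := ka2 m r h
        rw [min_eq_right hm]
        rw [max_eq_right (by linarith [hC hm])] at h'
        linarith
      · intro i r h
        have := hb1 _ _ h
        have := le_max_left 0 (C i - C k)
        linarith
    · have := lo2 k k 0 zb1
      simpa using this
  refine ⟨y, ?_, ?_, ?_, ?_, ?_, ?_, ?_⟩
  · intro m n hmn
    have hCmn := hC hmn
    constructor
    · have : y m ≤ y n := by
        apply up
        · intro l r h
          have := hC (min_le_min_right l hmn)
          linarith [lo1 n l r h]
        · intro i r h
          have : max 0 (C i - C n) ≤ max 0 (C i - C m) := max_le_max le_rfl (by linarith)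
          linarith [lo2 n i r h]
      linarith
    · have : y n ≤ y m + (C n - C m) := by
        apply up
        · intro l r h
          have h1 := lo1 m l r h
          have : C (min n l) ≤ C (min m l) + (C n - C m) := by
            rcases le_total l m with h | h
            · rw [min_eq_right h, min_eq_right (h.trans hmn)]; linarith
            · rw [min_eq_left h]
              linarith [hC (min_le_left n l)]
          linarith
        · intro i r h
          have h1 := lo2 m i r h
          have : max 0 (C i - C m) ≤ max 0 (C i - C n) + (C n - C m) := by
            apply max_le
            · linarith [le_max_left 0 (C i - C n)]
            · linarith [le_max_right 0 (C i - C n)]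
          linarith
      linarith
  · intro j r h
    rw [y0, sub_zero]
    apply up
    · intro m r' h'
      linarith [O1 j m r r' h h']
    · intro i r' h'
      linarith [hY1 _ (Or.inr ⟨j, i, r, r', h, h', rfl⟩)]
  · intro j r h
    have := lo2 j j r h
    rw [yk]
    simp at this
    linarith
  · intro r h
    rw [yk, y0]
    linarith [hY1 _ (Or.inl h)]
  · intro j r h
    have := lo1 j j r h
    rw [y0, hC0]
    simp at this
    linarith
  · intro j r h
    rw [yk]
    have : y j ≤ r + Y - C k + C j := by
      apply up
      · intro m r' h'
        have h2 := hY2 _ (Or.inr ⟨m, j, r', r, h', h, rfl⟩)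
        have : C (min j m) + max 0 (C j - C m) ≤ C j := by
          rcases le_total j m with h | h
          · rw [min_eq_left h, max_eq_left (by linarith [hC h])]; linarith
          · rw [min_eq_right h, max_eq_right (by linarith [hC h])]; linarith
        linarith
      · intro i r' h'
        have h2 := O2 i j r' r h' h
        have : C (max i j) ≤ max 0 (C i - C j) + C j := by
          rcases le_total i j with h | h
          · rw [max_eq_right h]; linarith [le_max_left 0 (C i - C j)]
          · rw [max_eq_left h]; linarith [le_max_right 0 (C i - C j)]
        linarith
    linarith
  · intro r h
    rw [yk, y0, hC0]
    linarith [hY2 _ (Or.inl h)]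

section K4

open SimpleGraph

variable {G : SimpleGraph V}

set_option linter.unusedDecidableInType false
set_option linter.unusedSectionVars false

lemma extend_link {X Y Z : Set V} (hX : (G.induce X).Connected) (hXY : Disjoint X Y)
    (hXZ : Disjoint X Z) {u w : V} (p : G.Walk u w) (hu : u ∈ X) (hw : w ∈ Y)
    (hp : ∀ v ∈ p.support, v ∉ Z) :
    ∃ X' : Set V, X ⊆ X' ∧ (G.induce X').Connected ∧ Disjoint X' Y ∧ Disjoint X' Z ∧
      ∃ a ∈ X', ∃ b ∈ Y, G.Adj a b := by
  induction p generalizing X with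
  | nil => exact absurd hw (Set.disjoint_left.1 hXY hu)
  | @cons u u' w h p ih =>
    by_cases hu' : u' ∈ Y
    · exact ⟨X, subset_rfl, hX, hXY, hXZ, u, hu, u', hu', h⟩
    · have hc : (G.induce (X ∪ {u, u'})).Connected :=
        induce_union_connected hX.preconnected (induce_pair_connected_of_adj h).preconnected
          ⟨u, hu, by simp⟩
      have hY : Disjoint (X ∪ {u, u'}) Y := by
        rw [Set.disjoint_left] at hXY ⊢
        rintro v (hv | hv | hv)
        · exact hXY hv
        · exact hv ▸ hXY hu
        · exact hv ▸ hu'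
      have hZ : Disjoint (X ∪ {u, u'}) Z := by
        rw [Set.disjoint_left] at hXZ ⊢
        rintro v (hv | hv | hv)
        · exact hXZ hv
        · exact hv ▸ hXZ hu
        · exact hv ▸ hp u' (by simp)
      obtain ⟨X', h1, h2⟩ := ih hc hY hZ (by simp) hw (fun v hv => hp v (by simp [hv]))
      exact ⟨X', Set.subset_union_left.trans h1, h2⟩

lemma k4_of_four {X Y Z W : Set V} (hX : (G.induce X).Connected) (hY : (G.induce Y).Connected)
    (hZ : (G.induce Z).Connected) (hW : (G.induce W).Connected)
    (dXY : Disjoint X Y) (dXZ : Disjoint X Z) (dXW : Disjoint X W)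
    (dYZ : Disjoint Y Z) (dYW : Disjoint Y W) (dZW : Disjoint Z W)
    (aXY : ∃ p ∈ X, ∃ q ∈ Y, G.Adj p q) (aXZ : ∃ p ∈ X, ∃ q ∈ Z, G.Adj p q)
    (aXW : ∃ p ∈ X, ∃ q ∈ W, G.Adj p q) (aYZ : ∃ p ∈ Y, ∃ q ∈ Z, G.Adj p q)
    (aYW : ∃ p ∈ Y, ∃ q ∈ W, G.Adj p q) (aZW : ∃ p ∈ Z, ∃ q ∈ W, G.Adj p q) :
    HasK4Minor G := by
  have sy : ∀ {A B : Set V}, (∃ p ∈ A, ∃ q ∈ B, G.Adj p q) → ∃ p ∈ B, ∃ q ∈ A, G.Adj p q := by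
    rintro A B ⟨p, hp, q, hq, h⟩
    exact ⟨q, hq, p, hp, h.symm⟩
  have ne : ∀ {A : Set V}, (G.induce A).Connected → A.Nonempty := fun h =>
    Set.nonempty_coe_sort.1 h.nonempty
  refine ⟨![X, Y, Z, W], ?_, ?_, ?_, ?_⟩
  · intro i
    fin_cases i
    exacts [ne hX, ne hY, ne hZ, ne hW]
  · intro i
    fin_cases i
    exacts [hX, hY, hZ, hW]
  · intro i j hij
    fin_cases i <;> fin_cases j <;> first | exact absurd rfl hij | skip
    exacts [dXY, dXZ, dXW, dXY.symm, dYZ, dYW, dXZ.symm, dYZ.symm, dZW, dXW.symm, dYW.symm,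
      dZW.symm]
  · intro i j hij
    fin_cases i <;> fin_cases j <;> first | exact absurd rfl hij | skip
    exacts [aXY, aXZ, aXW, sy aXY, aYZ, aYW, sy aXZ, sy aYZ, aZW, sy aXW, sy aYW, sy aZW]

/-- List of edges of the segment from `x m` to `x n`. -/
def segL (x : ℕ → V) (m n : ℕ) : List (Sym2 V) := (List.Ico m n).map fun l => s(x l, x (l + 1))

lemma exists_seg {k : ℕ} {x : ℕ → V} (adj : ∀ l < k, G.Adj (x l) (x (l + 1))) (m n : ℕ)
    (hmn : m ≤ n) (hn : n ≤ k) :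
    ∃ p : G.Walk (x m) (x n), (∀ v, v ∈ p.support ↔ ∃ l, m ≤ l ∧ l ≤ n ∧ v = x l) ∧
      p.edges = segL x m n := by
  induction n, hmn using Nat.le_induction with
  | base =>
    refine ⟨Walk.nil, ?_, by simp [segL]⟩
    intro v
    constructor
    · intro h
      exact ⟨m, le_rfl, le_rfl, by simpa using h⟩
    · rintro ⟨l, h1, h2, rfl⟩
      obtain rfl : l = m := by omega
      simp
  | succ n hmn ih =>
    obtain ⟨p, hp, he⟩ := ih (by omega)
    refine ⟨p.concat (adj n (by omega)), ?_, ?_⟩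
    · intro v
      rw [Walk.support_concat, List.mem_append, hp, List.mem_singleton]
      constructor
      · rintro (⟨l, h1, h2, rfl⟩ | rfl)
        · exact ⟨l, h1, by omega, rfl⟩
        · exact ⟨n + 1, by omega, le_rfl, rfl⟩
      · rintro ⟨l, h1, h2, rfl⟩
        rcases Nat.lt_or_ge n l with h | h
        · obtain rfl : l = n + 1 := by omega
          exact Or.inr rfl
        · exact Or.inl ⟨l, h1, h, rfl⟩
    · rw [Walk.edges_concat, he, List.concat_eq_append]
      simp [segL, List.Ico.succ_top hmn]

lemma exists_before_last {z y : V} (p : G.Walk z y) (h : z ≠ y) :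
    ∃ q, ∃ w : G.Walk z q, G.Adj q y ∧ (∀ v ∈ w.support, v ∈ p.support ∧ v ≠ y) := by
  induction p with
  | nil => exact absurd rfl h
  | @cons z z' y hz p ih =>
    by_cases hy : z' = y
    · subst hy
      exact ⟨z, Walk.nil, hz, by simp [h]⟩
    · obtain ⟨q, w, hq, hw⟩ := ih hy
      refine ⟨q, Walk.cons hz w, hq, ?_⟩
      intro v hv
      rw [Walk.support_cons, List.mem_cons] at hv
      rcases hv with rfl | hv
      · simp [h]
      · exact ⟨by simp [(hw v hv).1], (hw v hv).2⟩

lemma k4_core {k : ℕ} {x : ℕ → V} (adj : ∀ l < k, G.Adj (x l) (x (l + 1)))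
    (inj : ∀ m ≤ k, ∀ n ≤ k, x m = x n → m = n) {i j : ℕ} (hi : 0 < i) (hij : i < j) (hj : j < k)
    {s t : V} (A : G.Walk s (x 0)) (B : G.Walk (x k) t) (a : G.Walk s (x j)) (b : G.Walk (x i) t)
    (hA : ∀ v ∈ A.support, ∀ n ≤ k, v = x n → n = 0)
    (hB : ∀ v ∈ B.support, ∀ n ≤ k, v = x n → n = k)
    (ha : ∀ v ∈ a.support, ∀ n ≤ k, v = x n → n = j)
    (hb : ∀ v ∈ b.support, ∀ n ≤ k, v = x n → n = i)
    (dAB : ∀ v ∈ A.support, v ∉ B.support) (dAb : ∀ v ∈ A.support, v ∉ b.support)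
    (daB : ∀ v ∈ a.support, v ∉ B.support) (dab : ∀ v ∈ a.support, v ∉ b.support)
    {m n : ℕ} (hm : m < i) (hn : j < n) (hnk : n ≤ k) (p : G.Walk (x m) (x n))
    (hp : ∀ v ∈ p.support, ∀ l, i ≤ l → l ≤ j → v ≠ x l) : HasK4Minor G := by
  obtain ⟨qa, wa, hqa, hwa⟩ := exists_before_last a (by
    intro h
    have := hA s (by simp) j (by omega) h
    omega)
  obtain ⟨qb, wb, hqb, hwb⟩ := exists_before_last b.reverse (by
    intro h
    have := hB t (by simp) i (by omega) h
    omega)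
  simp only [Walk.support_reverse, List.mem_reverse] at hwb
  obtain ⟨σ, hσ, -⟩ := exists_seg adj 0 (i - 1) (by omega) (by omega)
  obtain ⟨τ, hτ, -⟩ := exists_seg adj (j + 1) k (by omega) (by omega)
  obtain ⟨ρ, hρ, -⟩ := exists_seg adj i (j - 1) (by omega) (by omega)
  set X : Set V := ({v | v ∈ A.support} ∪ {v | v ∈ wa.support}) ∪ {v | v ∈ σ.support} with hXd
  set Y : Set V := ({v | v ∈ B.support} ∪ {v | v ∈ wb.support}) ∪ {v | v ∈ τ.support} with hYd
  have hX : (G.induce X).Connected := by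
    apply induce_union_connected _ σ.connected_induce_support.preconnected ⟨x 0, by simp, by simp⟩
    exact (induce_union_connected A.connected_induce_support.preconnected
      wa.connected_induce_support.preconnected ⟨s, by simp, by simp⟩).preconnected
  have hY : (G.induce Y).Connected := by
    apply induce_union_connected _ τ.connected_induce_support.preconnected ⟨x k, by simp, by simp⟩
    exact (induce_union_connected B.connected_induce_support.preconnected
      wb.connected_induce_support.preconnected ⟨t, by simp, by simp⟩).preconnected
  have hXY : Disjoint X Y := by
    rw [Set.disjoint_left]
    rintro v ((h1 | h1) | h1) ((h2 | h2) | h2)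
    · exact dAB v h1 h2
    · exact dAb v h1 (hwb v h2).1
    · obtain ⟨l, hl1, hl2, rfl⟩ := (hτ v).1 h2
      have := hA _ h1 l hl2 rfl
      omega
    · exact daB v (hwa v h1).1 h2
    · exact dab v (hwa v h1).1 (hwb v h2).1
    · obtain ⟨l, hl1, hl2, rfl⟩ := (hτ v).1 h2
      have := ha _ (hwa _ h1).1 l hl2 rfl
      omega
    · obtain ⟨l, hl1, hl2, rfl⟩ := (hσ v).1 h1
      have := hB _ h2 l (by omega) rfl
      omega
    · obtain ⟨l, hl1, hl2, rfl⟩ := (hσ v).1 h1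
      have := hb _ (hwb _ h2).1 l (by omega) rfl
      omega
    · obtain ⟨l, hl1, hl2, rfl⟩ := (hσ v).1 h1
      obtain ⟨l', hl1', hl2', h⟩ := (hτ _).1 h2
      have := inj l (by omega) l' hl2' h
      omega
  set Z : Set V := {v | ∃ l, i ≤ l ∧ l ≤ j ∧ v = x l} with hZd
  have hXZ : Disjoint X Z := by
    rw [Set.disjoint_left]
    rintro v h1 ⟨l, hl1, hl2, rfl⟩
    rcases h1 with (h1 | h1) | h1
    · have := hA _ h1 l (by omega) rfl
      omega
    · have h3 := ha _ (hwa _ h1).1 l (by omega) rfl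
      exact (hwa _ h1).2 (by rw [h3])
    · obtain ⟨l', hl1', hl2', h⟩ := (hσ _).1 h1
      have := inj l (by omega) l' (by omega) h
      omega
  have hYZ : Disjoint Y Z := by
    rw [Set.disjoint_left]
    rintro v h1 ⟨l, hl1, hl2, rfl⟩
    rcases h1 with (h1 | h1) | h1
    · have := hB _ h1 l (by omega) rfl
      omega
    · have h3 := hb _ (hwb _ h1).1 l (by omega) rfl
      exact (hwb _ h1).2 (by rw [h3])
    · obtain ⟨l', hl1', hl2', h⟩ := (hτ _).1 h1
      have := inj l (by omega) l' (by omega) h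
      omega
  obtain ⟨X', hXX', hX', dX'Y, dX'Z, aX'Y⟩ := extend_link hX hXY hXZ p
    (Or.inr ((hσ _).2 ⟨m, by omega, by omega, rfl⟩)) (Or.inr ((hτ _).2 ⟨n, by omega, hnk, rfl⟩))
    (by
      rintro v hv ⟨l, h1, h2, h3⟩
      exact hp v hv l h1 h2 h3)
  have hρZ : {v | v ∈ ρ.support} ⊆ Z := by
    intro v hv
    obtain ⟨l, h1, h2, h3⟩ := (hρ v).1 hv
    exact ⟨l, h1, by omega, h3⟩
  have hjZ : ({x j} : Set V) ⊆ Z := by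
    rintro v rfl
    exact ⟨j, hij.le, le_rfl, rfl⟩
  have a1 : G.Adj (x (i - 1)) (x i) := by
    have := adj (i - 1) (by omega)
    rwa [Nat.sub_add_cancel hi] at this
  have a2 : G.Adj (x (j - 1)) (x j) := by
    have := adj (j - 1) (by omega)
    rwa [Nat.sub_add_cancel (by omega)] at this
  have hjc : (G.induce ({x j} : Set V)).Connected := by
    simp
  refine k4_of_four hX' hY ρ.connected_induce_support hjc dX'Y (dX'Z.mono_right hρZ)
    (dX'Z.mono_right hjZ) (hYZ.mono_right hρZ) (hYZ.mono_right hjZ) ?_ aX'Y ?_ ?_ ?_ ?_ ?_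
  · rw [Set.disjoint_left]
    rintro v h1 rfl
    obtain ⟨l, hl1, hl2, h⟩ := (hρ _).1 h1
    have := inj j (by omega) l (by omega) h
    omega
  · exact ⟨x (i - 1), hXX' (Or.inr ((hσ _).2 ⟨i - 1, by omega, le_rfl, rfl⟩)), x i, by simp, a1⟩
  · exact ⟨qa, hXX' (Or.inl (Or.inr (by simp))), x j, rfl, hqa⟩
  · exact ⟨qb, Or.inl (Or.inr (by simp)), x i, by simp, hqb⟩
  · exact ⟨x (j + 1), Or.inr ((hτ _).2 ⟨j + 1, le_rfl, by omega, rfl⟩), x j, rfl, (adj j hj).symm⟩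
  · exact ⟨x (j - 1), (hρ _).2 ⟨j - 1, by omega, le_rfl, rfl⟩, x j, rfl, a2⟩

end K4

section CoreSection

open SimpleGraph

variable {G : SimpleGraph V}

set_option linter.unusedSectionVars false

/-- Cost of a walk, with multiplicities. -/
def wc (c : Sym2 V → ℝ) {u v : V} (p : G.Walk u v) : ℝ := (p.edges.map c).sum

/-- Prefix costs along a sequence of vertices. -/
def CC (c : Sym2 V → ℝ) (x : ℕ → V) (n : ℕ) : ℝ := ∑ l ∈ Finset.range n, c s(x l, x (l + 1))

/-- Connectivity by means of the edges in a list. -/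
def RL (L : List (Sym2 V)) (u v : V) : Prop := (fromEdgeSet {e | e ∈ L}).Reachable u v

lemma RL.symm {L : List (Sym2 V)} {u v : V} (h : RL L u v) : RL L v u := Reachable.symm h

lemma RL.trans {L : List (Sym2 V)} {u v w : V} (h : RL L u v) (h' : RL L v w) : RL L u w :=
  Reachable.trans h h'

lemma RL_of_walk {L : List (Sym2 V)} {u v : V} (p : G.Walk u v) (h : ∀ e ∈ p.edges, e ∈ L) :
    RL L u v :=
  ⟨p.transfer _ (fun e he => by
    rw [edgeSet_fromEdgeSet]
    exact ⟨h e he, G.not_isDiag_of_mem_edgeSet (p.edges_subset_edgeSet he)⟩)⟩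

lemma RL_seg {k : ℕ} {x : ℕ → V} (adj : ∀ l < k, G.Adj (x l) (x (l + 1))) {L : List (Sym2 V)}
    {m n : ℕ} (hmn : m ≤ n) (hn : n ≤ k) (h : ∀ l, m ≤ l → l < n → s(x l, x (l + 1)) ∈ L) :
    RL L (x m) (x n) := by
  obtain ⟨p, -, hp⟩ := exists_seg adj m n hmn hn
  refine RL_of_walk p ?_
  rw [hp]
  intro e he
  simp only [segL, List.mem_map, List.Ico.mem] at he
  obtain ⟨l, ⟨h1, h2⟩, rfl⟩ := he
  exact h l h1 h2

lemma mem_segL {x : ℕ → V} {m n l : ℕ} (h1 : m ≤ l) (h2 : l < n) :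
    s(x l, x (l + 1)) ∈ segL x m n := by
  simp only [segL, List.mem_map, List.Ico.mem]
  exact ⟨l, ⟨h1, h2⟩, rfl⟩

lemma segL_edge {k : ℕ} {x : ℕ → V} (adj : ∀ l < k, G.Adj (x l) (x (l + 1))) {m n : ℕ}
    (hn : n ≤ k) : ∀ e ∈ segL x m n, e ∈ G.edgeSet := by
  intro e he
  simp only [segL, List.mem_map, List.Ico.mem] at he
  obtain ⟨l, ⟨h1, h2⟩, rfl⟩ := he
  exact adj l (by omega)

lemma sum_segL (c : Sym2 V → ℝ) (x : ℕ → V) {m n : ℕ} (h : m ≤ n) :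
    ((segL x m n).map c).sum = CC c x n - CC c x m := by
  induction n, h using Nat.le_induction with
  | base => simp [segL]
  | succ n hmn ih =>
    simp only [segL, List.map_map] at ih ⊢
    rw [List.Ico.succ_top hmn]
    simp only [List.map_append, List.sum_append, ih, CC, Finset.sum_range_succ]
    simp
    ring

lemma CC_mono {c : Sym2 V → ℝ} (c0 : ∀ e, 0 ≤ c e) (x : ℕ → V) : Monotone (CC c x) := by
  apply monotone_nat_of_le_succ
  intro n
  simp only [CC, Finset.sum_range_succ]
  linarith [c0 s(x n, x (n + 1))]

lemma wc_nonneg {c : Sym2 V → ℝ} (c0 : ∀ e, 0 ≤ c e) {u v : V} (p : G.Walk u v) : 0 ≤ wc c p := by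
  apply List.sum_nonneg
  simp only [List.mem_map]
  rintro _ ⟨e, -, rfl⟩
  exact c0 e

lemma wc_append (c : Sym2 V → ℝ) {u v w : V} (p : G.Walk u v) (q : G.Walk v w) :
    wc c (p.append q) = wc c p + wc c q := by simp [wc]

lemma wc_reverse (c : Sym2 V → ℝ) {u v : V} (p : G.Walk u v) : wc c p.reverse = wc c p := by
  simp [wc]

lemma wc_cons (c : Sym2 V → ℝ) {u v w : V} (h : G.Adj u v) (q : G.Walk v w) :
    wc c (Walk.cons h q) = c s(u, v) + wc c q := by simp [wc]

lemma exists_split (c : Sym2 V → ℝ) {u v w : V} (p : G.Walk u v) (h : w ∈ p.support) :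
    ∃ (q : G.Walk u w) (r : G.Walk w v), wc c q + wc c r = wc c p := by
  refine ⟨p.takeUntil w h, p.dropUntil w h, ?_⟩
  rw [← wc_append, Walk.take_spec]

/-- The combinatorial core situation: the paths of the two players are `A₁ S B₁` and `A₂ S B₂`,
where `S` is the path `x 0, …, x k`. -/
structure Core (G : SimpleGraph V) (c : Sym2 V → ℝ) (k : ℕ) (x : ℕ → V) (s₁ t₁ s₂ t₂ : V) where
  c0 : ∀ e, 0 ≤ c e
  nk4 : ¬ HasK4Minor G
  adj : ∀ l < k, G.Adj (x l) (x (l + 1))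
  inj : ∀ m ≤ k, ∀ n ≤ k, x m = x n → m = n
  A₁ : G.Walk s₁ (x 0)
  B₁ : G.Walk (x k) t₁
  A₂ : G.Walk s₂ (x 0)
  B₂ : G.Walk (x k) t₂
  hA₁ : ∀ v ∈ A₁.support, ∀ n ≤ k, v = x n → n = 0
  hB₁ : ∀ v ∈ B₁.support, ∀ n ≤ k, v = x n → n = k
  hA₂ : ∀ v ∈ A₂.support, ∀ n ≤ k, v = x n → n = 0
  hB₂ : ∀ v ∈ B₂.support, ∀ n ≤ k, v = x n → n = k
  d₁ : 0 < k → ∀ v ∈ A₁.support, v ∉ B₁.support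
  d₂ : 0 < k → ∀ v ∈ A₂.support, v ∉ B₂.support
  opt : ∀ L : List (Sym2 V), (∀ e ∈ L, e ∈ G.edgeSet) → RL L s₁ t₁ → RL L s₂ t₂ →
    wc c A₁ + wc c B₁ + (wc c A₂ + wc c B₂) + CC c x k ≤ (L.map c).sum

namespace Core

variable {c : Sym2 V → ℝ} {k : ℕ} {x : ℕ → V} {s₁ t₁ s₂ t₂ : V}

/-- Exchange the two players. -/
def swap (K : Core G c k x s₁ t₁ s₂ t₂) : Core G c k x s₂ t₂ s₁ t₁ where
  c0 := K.c0
  nk4 := K.nk4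
  adj := K.adj
  inj := K.inj
  A₁ := K.A₂
  B₁ := K.B₂
  A₂ := K.A₁
  B₂ := K.B₁
  hA₁ := K.hA₂
  hB₁ := K.hB₂
  hA₂ := K.hA₁
  hB₂ := K.hB₁
  d₁ := K.d₂
  d₂ := K.d₁
  opt := fun L h h1 h2 => by linarith [K.opt L h h2 h1]

lemma E1 (K : Core G c k x s₁ t₁ s₂ t₂) {n j m : ℕ} (hj : n ≤ j) (hm : n ≤ m) (hjk : j ≤ k)
    (hmk : m ≤ k) (a : G.Walk s₁ (x j)) (a' : G.Walk s₂ (x m)) :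
    wc c K.A₁ + wc c K.A₂ + CC c x n ≤ wc c a + wc c a' := by
  have h := K.opt (a.edges ++ a'.edges ++ segL x n k ++ K.B₁.edges ++ K.B₂.edges) ?_ ?_ ?_
  · simp only [List.map_append, List.sum_append] at h
    rw [sum_segL c x (hj.trans hjk)] at h
    change _ ≤ wc c a + wc c a' + _ + wc c K.B₁ + wc c K.B₂ at h
    linarith
  · intro e he
    simp only [List.mem_append] at he
    rcases he with (((he | he) | he) | he) | he
    · exact a.edges_subset_edgeSet he
    · exact a'.edges_subset_edgeSet he
    · exact segL_edge K.adj le_rfl e he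
    · exact K.B₁.edges_subset_edgeSet he
    · exact K.B₂.edges_subset_edgeSet he
  · refine (RL_of_walk a ?_).trans ((RL_seg K.adj hjk le_rfl ?_).trans (RL_of_walk K.B₁ ?_))
    · intro e he; simp [he]
    · intro l h1 h2; simp [mem_segL (x := x) (hj.trans h1) h2]
    · intro e he; simp [he]
  · refine (RL_of_walk a' ?_).trans ((RL_seg K.adj hmk le_rfl ?_).trans (RL_of_walk K.B₂ ?_))
    · intro e he; simp [he]
    · intro l h1 h2; simp [mem_segL (x := x) (hm.trans h1) h2]
    · intro e he; simp [he]

lemma E2 (K : Core G c k x s₁ t₁ s₂ t₂) {n i m : ℕ} (hi : i ≤ n) (hm : m ≤ n) (hnk : n ≤ k)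
    (b : G.Walk (x i) t₁) (b' : G.Walk (x m) t₂) :
    wc c K.B₁ + wc c K.B₂ + (CC c x k - CC c x n) ≤ wc c b + wc c b' := by
  have h := K.opt (b.edges ++ b'.edges ++ segL x 0 n ++ K.A₁.edges ++ K.A₂.edges) ?_ ?_ ?_
  · simp only [List.map_append, List.sum_append] at h
    rw [sum_segL c x (Nat.zero_le n)] at h
    change _ ≤ wc c b + wc c b' + _ + wc c K.A₁ + wc c K.A₂ at h
    have : CC c x 0 = 0 := by simp [CC]
    linarith
  · intro e he
    simp only [List.mem_append] at he
    rcases he with (((he | he) | he) | he) | he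
    · exact b.edges_subset_edgeSet he
    · exact b'.edges_subset_edgeSet he
    · exact segL_edge K.adj hnk e he
    · exact K.A₁.edges_subset_edgeSet he
    · exact K.A₂.edges_subset_edgeSet he
  · refine (RL_of_walk K.A₁ ?_).trans ((RL_seg K.adj (Nat.zero_le i) (by omega) ?_).trans
      (RL_of_walk b ?_))
    · intro e he; simp [he]
    · intro l h1 h2; simp [mem_segL (x := x) h1 (lt_of_lt_of_le h2 hi)]
    · intro e he; simp [he]
  · refine (RL_of_walk K.A₂ ?_).trans ((RL_seg K.adj (Nat.zero_le m) (by omega) ?_).trans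
      (RL_of_walk b' ?_))
    · intro e he; simp [he]
    · intro l h1 h2; simp [mem_segL (x := x) h1 (lt_of_lt_of_le h2 hm)]
    · intro e he; simp [he]

/-- `S` is a shortest path between any two of its vertices. -/
lemma short (K : Core G c k x s₁ t₁ s₂ t₂) {m n : ℕ} (hmn : m ≤ n) (hn : n ≤ k)
    (R : G.Walk (x m) (x n)) : CC c x n - CC c x m ≤ wc c R := by
  have h := K.opt (R.edges ++ segL x 0 m ++ segL x n k ++ K.A₁.edges ++ K.A₂.edges ++
    K.B₁.edges ++ K.B₂.edges) ?_ ?_ ?_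
  · simp only [List.map_append, List.sum_append] at h
    rw [sum_segL c x (Nat.zero_le m), sum_segL c x hn] at h
    change _ ≤ wc c R + _ + _ + wc c K.A₁ + wc c K.A₂ + wc c K.B₁ + wc c K.B₂ at h
    have : CC c x 0 = 0 := by simp [CC]
    linarith
  · intro e he
    simp only [List.mem_append] at he
    rcases he with (((((he | he) | he) | he) | he) | he) | he
    · exact R.edges_subset_edgeSet he
    · exact segL_edge K.adj (hmn.trans hn) e he
    · exact segL_edge K.adj le_rfl e he
    · exact K.A₁.edges_subset_edgeSet he
    · exact K.A₂.edges_subset_edgeSet he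
    · exact K.B₁.edges_subset_edgeSet he
    · exact K.B₂.edges_subset_edgeSet he
  · refine (RL_of_walk K.A₁ ?_).trans ((RL_seg K.adj (Nat.zero_le m) (by omega) ?_).trans
      ((RL_of_walk R ?_).trans ((RL_seg K.adj hn le_rfl ?_).trans (RL_of_walk K.B₁ ?_))))
    · intro e he; simp [he]
    · intro l h1 h2; simp [mem_segL (x := x) h1 h2]
    · intro e he; simp [he]
    · intro l h1 h2; simp [mem_segL (x := x) h1 h2]
    · intro e he; simp [he]
  · refine (RL_of_walk K.A₂ ?_).trans ((RL_seg K.adj (Nat.zero_le m) (by omega) ?_).trans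
      ((RL_of_walk R ?_).trans ((RL_seg K.adj hn le_rfl ?_).trans (RL_of_walk K.B₂ ?_))))
    · intro e he; simp [he]
    · intro l h1 h2; simp [mem_segL (x := x) h1 h2]
    · intro e he; simp [he]
    · intro l h1 h2; simp [mem_segL (x := x) h1 h2]
    · intro e he; simp [he]

/-- Two arbitrary walks of the players. -/
lemma E0 (K : Core G c k x s₁ t₁ s₂ t₂) (Q : G.Walk s₁ t₁) (Q' : G.Walk s₂ t₂) :
    wc c K.A₁ + wc c K.B₁ + (wc c K.A₂ + wc c K.B₂) + CC c x k ≤ wc c Q + wc c Q' := by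
  have h := K.opt (Q.edges ++ Q'.edges) ?_ ?_ ?_
  · simp only [List.map_append, List.sum_append] at h
    exact h
  · intro e he
    simp only [List.mem_append] at he
    rcases he with he | he
    · exact Q.edges_subset_edgeSet he
    · exact Q'.edges_subset_edgeSet he
  · refine RL_of_walk Q ?_
    intro e he; simp [he]
  · refine RL_of_walk Q' ?_
    intro e he; simp [he]

end Core

/-- A walk of cost `r` from `z` to `x j` that otherwise avoids the path `x`. -/
def Leg (G : SimpleGraph V) (c : Sym2 V → ℝ) (k : ℕ) (x : ℕ → V) (z : V) (j : ℕ) (r : ℝ) : Prop :=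
  j ≤ k ∧ ∃ a : G.Walk z (x j), (∀ v ∈ a.support, ∀ n ≤ k, v = x n → n = j) ∧ wc c a = r

/-- A walk of cost `r` that avoids the path `x`. -/
def Direct (G : SimpleGraph V) (c : Sym2 V → ℝ) (k : ℕ) (x : ℕ → V) (s t : V) (r : ℝ) : Prop :=
  ∃ a : G.Walk s t, (∀ v ∈ a.support, ∀ n ≤ k, v ≠ x n) ∧ wc c a = r

/-- Crossing pairs of legs which are disjoint. -/
def Crossing (K : Core G c k x s₁ t₁ s₂ t₂) (r : ℝ) : Prop :=
  ∃ (i j : ℕ) (a : G.Walk s₁ (x j)) (b : G.Walk (x i) t₁), 0 < i ∧ i < j ∧ j < k ∧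
    (∀ v ∈ a.support, ∀ n ≤ k, v = x n → n = j) ∧
    (∀ v ∈ b.support, ∀ n ≤ k, v = x n → n = i) ∧
    wc c a + wc c b = wc c K.A₁ + wc c K.B₁ + r ∧
    ∀ (m n : ℕ) (p : G.Walk (x m) (x n)), m < i → j < n → n ≤ k →
      ¬ (∀ v ∈ p.support, ∀ l, i ≤ l → l ≤ j → v ≠ x l)

lemma classify (K : Core G c k x s₁ t₁ s₂ t₂) {r : ℝ}
    (h : RR (CC c x) (fun j r => Leg G c k x s₁ j (r + wc c K.A₁))
      (fun j r => Leg G c k x t₁ j (r + wc c K.B₁))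
      (fun r => Direct G c k x s₁ t₁ (r + (wc c K.A₁ + wc c K.B₁))) r) :
    (∃ Q : G.Walk s₁ t₁, wc c Q ≤ wc c K.A₁ + wc c K.B₁ + r) ∨ Crossing K r := by
  rcases h with ⟨Q, -, hQ⟩ | ⟨j, i, ra, rb, ⟨hj, a, ha, hra⟩, ⟨hi, b, hb, hrb⟩, rfl⟩
  · exact Or.inl ⟨Q, by linarith⟩
  rcases Nat.lt_or_ge i j with hij | hij
  · -- crossing case
    have hmax : max 0 (CC c x i - CC c x j) = 0 :=
      max_eq_left (by linarith [CC_mono K.c0 x hij.le])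
    have ea := K.E1 (Nat.zero_le j) (Nat.zero_le 0) hj (Nat.zero_le k) a K.A₂
    have eb := K.E2 hi le_rfl le_rfl b.reverse K.B₂
    have hC0 : CC c x 0 = 0 := by simp [CC]
    rw [wc_reverse] at eb
    rw [hmax]
    -- intersecting walks
    have key : ∀ {y z : V} (p : G.Walk s₁ y) (q : G.Walk t₁ z), wc c p ≤ wc c a →
        wc c q ≤ wc c b → (∃ v ∈ p.support, v ∈ q.support) →
        ∃ Q : G.Walk s₁ t₁, wc c Q ≤ wc c K.A₁ + wc c K.B₁ + (ra + rb + 0) := by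
      rintro y z p q hp hq ⟨v, hv1, hv2⟩
      obtain ⟨p1, p2, h1⟩ := exists_split c p hv1
      obtain ⟨q1, q2, h2⟩ := exists_split c q hv2
      refine ⟨p1.append q1.reverse, ?_⟩
      rw [wc_append, wc_reverse]
      have := wc_nonneg K.c0 p2
      have := wc_nonneg K.c0 q2
      linarith
    by_cases c1 : ∃ v ∈ a.support, v ∈ b.support
    · exact Or.inl (key a b le_rfl le_rfl c1)
    by_cases c2 : ∃ v ∈ K.A₁.support, v ∈ b.support
    · exact Or.inl (key K.A₁ b (by linarith) le_rfl c2)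
    by_cases c3 : ∃ v ∈ a.support, v ∈ K.B₁.support
    · refine Or.inl (key a K.B₁.reverse le_rfl (by rw [wc_reverse]; linarith) ?_)
      simpa using c3
    push Not at c1 c2 c3
    have hi0 : 0 < i := by
      rcases Nat.eq_zero_or_pos i with h | h
      · subst h
        exact absurd b.end_mem_support (c2 _ K.A₁.end_mem_support)
      · exact h
    have hjk : j < k := by
      rcases Nat.lt_or_ge j k with h | h
      · exact h
      · obtain rfl : j = k := by omega
        exact absurd K.B₁.start_mem_support (c3 _ a.end_mem_support)
    refine Or.inr ⟨i, j, a, b.reverse, hi0, hij, hjk, ha, by simpa using hb, ?_, ?_⟩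
    · rw [wc_reverse]; linarith
    · intro m n p hm hn hnk hp
      exact K.nk4 (k4_core K.adj K.inj hi0 hij hjk K.A₁ K.B₁ a b.reverse K.hA₁ K.hB₁ ha
        (by simpa using hb) (K.d₁ (by omega)) (by simpa using c2) c3 (by simpa using c1)
        hm hn hnk p hp)
  · obtain ⟨p, -, hp⟩ := exists_seg K.adj j i hij hi
    refine Or.inl ⟨a.append (p.append b.reverse), ?_⟩
    rw [wc_append, wc_append, wc_reverse]
    have : wc c p = CC c x i - CC c x j := by rw [wc, hp, sum_segL c x hij]
    have := le_max_right 0 (CC c x i - CC c x j)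
    linarith

lemma nice_crossing (K : Core G c k x s₁ t₁ s₂ t₂) {r r' : ℝ} (h : Crossing K r)
    (Q : G.Walk s₂ t₂) (hQ : wc c Q ≤ wc c K.A₂ + wc c K.B₂ + r') : CC c x k ≤ r + r' := by
  obtain ⟨i, j, a, b, hi, hij, hjk, ha, hb, hr, hK⟩ := h
  by_cases hh : ∃ n, i ≤ n ∧ n ≤ j ∧ x n ∈ Q.support
  · obtain ⟨n, h1, h2, h3⟩ := hh
    obtain ⟨q1, q2, hq⟩ := exists_split c Q h3
    have e1 := K.E1 h2 le_rfl hjk.le (by omega) a q1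
    have e2 := K.E2 h1 le_rfl (by omega) b q2
    linarith
  · exfalso
    push Not at hh
    refine hK 0 k (K.A₂.reverse.append (Q.append K.B₂.reverse)) hi hjk le_rfl ?_
    rintro v hv l h1 h2 rfl
    simp only [Walk.mem_support_append_iff, Walk.support_reverse, List.mem_reverse] at hv
    rcases hv with hv | hv | hv
    · have := K.hA₂ _ hv l (by omega) rfl
      omega
    · exact hh l h1 h2 hv
    · have := K.hB₂ _ hv l (by omega) rfl
      omega

lemma crossing_crossing (K : Core G c k x s₁ t₁ s₂ t₂) {r r' : ℝ} (h : Crossing K r)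
    (h' : Crossing K.swap r') : CC c x k ≤ r + r' := by
  obtain ⟨i, j, a, b, hi, hij, hjk, ha, hb, hr, hK⟩ := h
  obtain ⟨i', j', a', b', hi', hij', hjk', ha', hb', hr', -⟩ := h'
  change _ = wc c K.A₂ + wc c K.B₂ + r' at hr'
  rcases Nat.lt_or_ge j' i with h1 | h1
  · exfalso
    refine hK i' k (b'.append K.B₂.reverse) (by omega) hjk le_rfl ?_
    rintro v hv l h1 h2 rfl
    simp only [Walk.mem_support_append_iff, Walk.support_reverse, List.mem_reverse] at hv
    rcases hv with hv | hv
    · have := hb' _ hv l (by omega) rfl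
      omega
    · have := K.hB₂ _ hv l (by omega) rfl
      omega
  rcases Nat.lt_or_ge j i' with h2 | h2
  · exfalso
    refine hK 0 j' (K.A₂.reverse.append a') hi (by omega) hjk'.le ?_
    rintro v hv l h1 h2 rfl
    simp only [Walk.mem_support_append_iff, Walk.support_reverse, List.mem_reverse] at hv
    rcases hv with hv | hv
    · have := K.hA₂ _ hv l (by omega) rfl
      omega
    · have := ha' _ hv l (by omega) rfl
      omega
  have e1 := K.E1 (n := max i i') (max_le hij.le h2) (max_le h1 hij'.le) hjk.le hjk'.le a a'
  have e2 := K.E2 (n := max i i') (le_max_left _ _) (le_max_right _ _)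
    (max_le (by omega) (by omega)) b b'
  linarith

/-- Existence of the prefix shares. -/
lemma exists_shares (K : Core G c k x s₁ t₁ s₂ t₂) :
    ∃ y : ℕ → ℝ, (∀ m n, m ≤ n → 0 ≤ y n - y m ∧ y n - y m ≤ CC c x n - CC c x m) ∧
      (∀ j r, Leg G c k x s₁ j r → y j - y 0 + wc c K.A₁ ≤ r) ∧
      (∀ j r, Leg G c k x t₁ j r → y k - y j + wc c K.B₁ ≤ r) ∧
      (∀ r, Direct G c k x s₁ t₁ r → y k - y 0 + (wc c K.A₁ + wc c K.B₁) ≤ r) ∧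
      (∀ j r, Leg G c k x s₂ j r → (CC c x j - y j) - (CC c x 0 - y 0) + wc c K.A₂ ≤ r) ∧
      (∀ j r, Leg G c k x t₂ j r → (CC c x k - y k) - (CC c x j - y j) + wc c K.B₂ ≤ r) ∧
      (∀ r, Direct G c k x s₂ t₂ r → (CC c x k - y k) - (CC c x 0 - y 0) +
        (wc c K.A₂ + wc c K.B₂) ≤ r) := by
  obtain ⟨y, h0, h1, h2, h3, h4, h5, h6⟩ := lp k (CC c x) (CC_mono K.c0 x) (by simp [CC])
    (fun j r => Leg G c k x s₁ j (r + wc c K.A₁)) (fun j r => Leg G c k x t₁ j (r + wc c K.B₁))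
    (fun j r => Leg G c k x s₂ j (r + wc c K.A₂)) (fun j r => Leg G c k x t₂ j (r + wc c K.B₂))
    (fun r => Direct G c k x s₁ t₁ (r + (wc c K.A₁ + wc c K.B₁)))
    (fun r => Direct G c k x s₂ t₂ (r + (wc c K.A₂ + wc c K.B₂)))
    (fun j r h => h.1) (fun j r h => h.1)
    ⟨Nat.zero_le k, K.A₁, K.hA₁, by simp⟩
    ⟨le_rfl, K.B₁.reverse, by simpa using K.hB₁, by rw [wc_reverse]; simp⟩
    ⟨Nat.zero_le k, K.A₂, K.hA₂, by simp⟩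
    ⟨le_rfl, K.B₂.reverse, by simpa using K.hB₂, by rw [wc_reverse]; simp⟩
    (by
      rintro j m r r' ⟨hj, a, -, ha⟩ ⟨hm, b, -, hb⟩
      have := K.E1 (min_le_left j m) (min_le_right j m) hj hm a b
      linarith)
    (by
      rintro j m r r' ⟨hj, a, -, ha⟩ ⟨hm, b, -, hb⟩
      have := K.E2 (le_max_left j m) (le_max_right j m) (max_le hj hm) a.reverse b.reverse
      rw [wc_reverse, wc_reverse] at this
      linarith)
    (by
      intro r r' h h'
      rcases classify K h with ⟨Q, hQ⟩ | hc
      · rcases classify K.swap h' with ⟨Q', hQ'⟩ | hc'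
        · change _ ≤ wc c K.A₂ + wc c K.B₂ + r' at hQ'
          linarith [K.E0 Q Q']
        · linarith [nice_crossing K.swap hc' Q hQ]
      · rcases classify K.swap h' with ⟨Q', hQ'⟩ | hc'
        · exact nice_crossing K hc Q' hQ'
        · exact crossing_crossing K hc hc')
  refine ⟨y, h0, ?_, ?_, ?_, ?_, ?_, ?_⟩
  · intro j r h
    linarith [h1 j (r - wc c K.A₁) (by simpa using h)]
  · intro j r h
    linarith [h2 j (r - wc c K.B₁) (by simpa using h)]
  · intro r h
    linarith [h3 (r - (wc c K.A₁ + wc c K.B₁)) (by simpa using h)]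
  · intro j r h
    linarith [h4 j (r - wc c K.A₂) (by simpa using h)]
  · intro j r h
    linarith [h5 j (r - wc c K.B₂) (by simpa using h)]
  · intro r h
    linarith [h6 (r - (wc c K.A₂ + wc c K.B₂)) (by simpa using h)]

/-- Stability against deviations of one player. `d` is the modified cost function. -/
lemma tail_bound {c d : Sym2 V → ℝ} {k : ℕ} {x : ℕ → V} {t : V} {y : ℕ → ℝ} {β : ℝ}
    (sh : ∀ m ≤ k, ∀ n ≤ k, ∀ R : G.Walk (x m) (x n), y n - y m ≤ wc c R)
    (c0 : ∀ e, 0 ≤ c e) (inj : ∀ m ≤ k, ∀ n ≤ k, x m = x n → m = n)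
    (dS : ∀ m ≤ k, ∀ n ≤ k, G.Adj (x m) (x n) → y n - y m ≤ d s(x m, x n))
    (dc : ∀ u v, G.Adj u v → (∀ n ≤ k, u ≠ x n) ∨ (∀ n ≤ k, v ≠ x n) → d s(u, v) = c s(u, v))
    (hb : ∀ j r, Leg G c k x t j r → y k - y j + β ≤ r)
    {z : V} (R : G.Walk z t) (m : ℕ) (τ : ℝ) (hz : Leg G c k x z m τ) :
    y k - y m + β ≤ τ + wc d R := by
  induction R generalizing m τ with
  | nil => simpa [wc] using hb m τ hz
  | @cons z z' t h R ih =>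
    obtain ⟨hm, a, ha, rfl⟩ := hz
    rw [wc_cons]
    by_cases hz' : ∃ n ≤ k, z' = x n
    · obtain ⟨n, hn, rfl⟩ := hz'
      have h2 := ih hb n 0 ⟨hn, Walk.nil, by
        intro v hv l hl hvl
        simp only [Walk.support_nil, List.mem_singleton] at hv
        exact inj l hl n hn (by rw [← hvl, hv]), by simp [wc]⟩
      by_cases hz : ∃ l ≤ k, z = x l
      · obtain ⟨l, hl, rfl⟩ := hz
        obtain rfl : l = m := ha _ a.start_mem_support l hl rfl
        have := dS l hl n hn h
        have := wc_nonneg c0 a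
        linarith
      · push Not at hz
        have h3 := sh m hm n hn (a.reverse.append (Walk.cons h Walk.nil))
        rw [wc_append, wc_reverse, wc_cons, ← dc _ _ h (Or.inl hz)] at h3
        simp [wc] at h3 h2 ⊢
        linarith
    · push Not at hz'
      have := ih hb m (c s(z, z') + wc c a) ⟨hm, Walk.cons h.symm a, ?_, ?_⟩
      · rw [dc _ _ h (Or.inr hz')]
        linarith
      · intro v hv n hn hvn
        rw [Walk.support_cons, List.mem_cons] at hv
        rcases hv with rfl | hv
        · exact absurd hvn (hz' n hn)
        · exact ha v hv n hn hvn
      · rw [wc_cons, Sym2.eq_swap]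

lemma head_bound {c d : Sym2 V → ℝ} {k : ℕ} {x : ℕ → V} {s t : V} {y : ℕ → ℝ} {α β : ℝ}
    (sh : ∀ m ≤ k, ∀ n ≤ k, ∀ R : G.Walk (x m) (x n), y n - y m ≤ wc c R)
    (c0 : ∀ e, 0 ≤ c e) (inj : ∀ m ≤ k, ∀ n ≤ k, x m = x n → m = n)
    (dS : ∀ m ≤ k, ∀ n ≤ k, G.Adj (x m) (x n) → y n - y m ≤ d s(x m, x n))
    (dc : ∀ u v, G.Adj u v → (∀ n ≤ k, u ≠ x n) ∨ (∀ n ≤ k, v ≠ x n) → d s(u, v) = c s(u, v))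
    (ha : ∀ j r, Leg G c k x s j r → y j - y 0 + α ≤ r)
    (hb : ∀ j r, Leg G c k x t j r → y k - y j + β ≤ r)
    (hg : ∀ r, Direct G c k x s t r → y k - y 0 + (α + β) ≤ r)
    {z : V} (R : G.Walk z t) (T : G.Walk s z) (hT : ∀ v ∈ T.support, ∀ n ≤ k, v ≠ x n) :
    y k - y 0 + (α + β) ≤ wc c T + wc d R := by
  induction R with
  | nil => simpa [wc] using hg _ ⟨T, hT, rfl⟩
  | @cons z z' t h R ih =>
    have hz := hT z T.end_mem_support
    have hd := dc _ _ h (Or.inl hz)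
    rw [wc_cons, hd]
    by_cases hz' : ∃ n ≤ k, z' = x n
    · obtain ⟨n, hn, rfl⟩ := hz'
      have h1 := tail_bound sh c0 inj dS dc hb R n 0 ⟨hn, Walk.nil, by
        intro v hv l hl hvl
        simp only [Walk.support_nil, List.mem_singleton] at hv
        exact inj l hl n hn (by rw [← hvl, hv]), by simp [wc]⟩
      have h2 := ha n (wc c T + c s(z, x n)) ⟨hn, T.append (Walk.cons h Walk.nil), by
        intro v hv l hl hvl
        simp only [Walk.mem_support_append_iff, Walk.support_cons, Walk.support_nil,
          List.mem_cons, List.not_mem_nil, or_false] at hv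
        rcases hv with hv | rfl | rfl
        · exact absurd hvl (hT v hv l hl)
        · exact absurd hvl (hz l hl)
        · exact (inj n hn l hl hvl).symm, by rw [wc_append, wc_cons]; simp [wc]⟩
      linarith
    · push Not at hz'
      have := ih hb hg (T.append (Walk.cons h Walk.nil)) (by
        intro v hv
        simp only [Walk.mem_support_append_iff, Walk.support_cons, Walk.support_nil,
          List.mem_cons, List.not_mem_nil, or_false] at hv
        rcases hv with hv | rfl | rfl
        · exact hT v hv
        · exact hz
        · exact hz')
      rw [wc_append, wc_cons] at this
      have h0 : wc c (Walk.nil : G.Walk z' z') = 0 := by simp [wc]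
      linarith

lemma walk_bound {c d : Sym2 V → ℝ} {k : ℕ} {x : ℕ → V} {s t : V} {y : ℕ → ℝ} {α β : ℝ}
    (sh : ∀ m ≤ k, ∀ n ≤ k, ∀ R : G.Walk (x m) (x n), y n - y m ≤ wc c R)
    (c0 : ∀ e, 0 ≤ c e) (inj : ∀ m ≤ k, ∀ n ≤ k, x m = x n → m = n)
    (dS : ∀ m ≤ k, ∀ n ≤ k, G.Adj (x m) (x n) → y n - y m ≤ d s(x m, x n))
    (dc : ∀ u v, G.Adj u v → (∀ n ≤ k, u ≠ x n) ∨ (∀ n ≤ k, v ≠ x n) → d s(u, v) = c s(u, v))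
    (ha : ∀ j r, Leg G c k x s j r → y j - y 0 + α ≤ r)
    (hb : ∀ j r, Leg G c k x t j r → y k - y j + β ≤ r)
    (hg : ∀ r, Direct G c k x s t r → y k - y 0 + (α + β) ≤ r) (Q : G.Walk s t) :
    y k - y 0 + (α + β) ≤ wc d Q := by
  by_cases hs : ∃ n ≤ k, s = x n
  · obtain ⟨n, hn, rfl⟩ := hs
    have hl : Leg G c k x (x n) n 0 := ⟨hn, Walk.nil, by
        intro v hv l hl hvl
        simp only [Walk.support_nil, List.mem_singleton] at hv
        exact inj l hl n hn (by rw [← hvl, hv]), by simp [wc]⟩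
    have h1 := tail_bound sh c0 inj dS dc hb Q n 0 hl
    have h2 := ha n 0 hl
    linarith
  · push Not at hs
    have := head_bound sh c0 inj dS dc ha hb hg Q Walk.nil (by simpa using hs)
    simpa [wc] using this

end CoreSection

section ShareSection

set_option linter.unusedSectionVars false

open SimpleGraph

variable {G : SimpleGraph V} {c : Sym2 V → ℝ} {k : ℕ} {x : ℕ → V} {s₁ t₁ s₂ t₂ : V}

lemma mem_segL_iff {m n : ℕ} {e : Sym2 V} :
    e ∈ segL x m n ↔ ∃ l, m ≤ l ∧ l < n ∧ e = s(x l, x (l + 1)) := by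
  simp only [segL, List.mem_map, List.Ico.mem]
  constructor
  · rintro ⟨l, ⟨h1, h2⟩, rfl⟩
    exact ⟨l, h1, h2, rfl⟩
  · rintro ⟨l, h1, h2, rfl⟩
    exact ⟨l, ⟨h1, h2⟩, rfl⟩

/-- Two equal edges of the path `x`. -/
lemma edge_index (inj : ∀ m ≤ k, ∀ n ≤ k, x m = x n → m = n) {m n l : ℕ} (hm : m ≤ k)
    (hn : n ≤ k) (hl : l < k) (h : s(x m, x n) = s(x l, x (l + 1))) :
    (m = l ∧ n = l + 1) ∨ (m = l + 1 ∧ n = l) := by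
  rw [Sym2.eq_iff] at h
  rcases h with ⟨h1, h2⟩ | ⟨h1, h2⟩
  · exact Or.inl ⟨inj m hm l hl.le h1, inj n hn (l + 1) hl h2⟩
  · exact Or.inr ⟨inj m hm (l + 1) hl h1, inj n hn l hl.le h2⟩

/-- The modified cost function of a player. -/
def dcost (c ξ : Sym2 V → ℝ) (L : List (Sym2 V)) (e : Sym2 V) : ℝ := if e ∈ L then ξ e else c e

lemma player_bound (K : Core G c k x s₁ t₁ s₂ t₂) {y : ℕ → ℝ} {ξ : Sym2 V → ℝ}
    (hy : ∀ m n, m ≤ n → 0 ≤ y n - y m ∧ y n - y m ≤ CC c x n - CC c x m)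
    (hξ : ∀ l < k, ξ s(x l, x (l + 1)) = y (l + 1) - y l)
    (ha : ∀ j r, Leg G c k x s₁ j r → y j - y 0 + wc c K.A₁ ≤ r)
    (hb : ∀ j r, Leg G c k x t₁ j r → y k - y j + wc c K.B₁ ≤ r)
    (hg : ∀ r, Direct G c k x s₁ t₁ r → y k - y 0 + (wc c K.A₁ + wc c K.B₁) ≤ r)
    (Q : G.Walk s₁ t₁) :
    y k - y 0 + (wc c K.A₁ + wc c K.B₁) ≤ wc (dcost c ξ (segL x 0 k)) Q := by
  have sh : ∀ m ≤ k, ∀ n ≤ k, ∀ R : G.Walk (x m) (x n), y n - y m ≤ wc c R := by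
    intro m hm n hn R
    rcases le_total m n with h | h
    · linarith [(hy m n h).2, K.short h hn R]
    · linarith [(hy n m h).1, wc_nonneg K.c0 R]
  refine walk_bound sh K.c0 K.inj ?_ ?_ ha hb hg Q
  · intro m hm n hn h
    unfold dcost
    split_ifs with he
    · obtain ⟨l, -, hl, he⟩ := mem_segL_iff.1 he
      rw [he, hξ l hl]
      rcases edge_index K.inj hm hn hl he with ⟨rfl, rfl⟩ | ⟨rfl, rfl⟩
      · exact le_rfl
      · linarith [(hy n (n + 1) (by omega)).1]
    · simpa [wc] using sh m hm n hn (Walk.cons h Walk.nil)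
  · intro u v h huv
    unfold dcost
    rw [if_neg]
    intro he
    obtain ⟨l, -, hl, he⟩ := mem_segL_iff.1 he
    rw [Sym2.eq_iff] at he
    rcases he with ⟨rfl, rfl⟩ | ⟨rfl, rfl⟩
    · rcases huv with h | h
      · exact h l hl.le rfl
      · exact h (l + 1) hl rfl
    · rcases huv with h | h
      · exact h (l + 1) hl rfl
      · exact h l hl.le rfl

lemma CC_eq {ξ : Sym2 V → ℝ} {y : ℕ → ℝ} (hξ : ∀ l < k, ξ s(x l, x (l + 1)) = y (l + 1) - y l) :
    CC ξ x k = y k - y 0 := by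
  unfold CC
  rw [← Finset.sum_range_sub]
  exact Finset.sum_congr rfl fun l hl => hξ l (Finset.mem_range.1 hl)

/-- Stable shares exist in the core situation. -/
lemma core_shares (K : Core G c k x s₁ t₁ s₂ t₂) :
    ∃ ξ : Sym2 V → ℝ, (∀ e ∈ segL x 0 k, 0 ≤ ξ e ∧ ξ e ≤ c e) ∧
      (∀ Q : G.Walk s₁ t₁, CC ξ x k + (wc c K.A₁ + wc c K.B₁) ≤
        wc (dcost c ξ (segL x 0 k)) Q) ∧
      (∀ Q : G.Walk s₂ t₂, CC (fun e => c e - ξ e) x k + (wc c K.A₂ + wc c K.B₂) ≤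
        wc (dcost c (fun e => c e - ξ e) (segL x 0 k)) Q) := by
  classical
  obtain ⟨y, h0, h1, h2, h3, h4, h5, h6⟩ := exists_shares K
  let ξ : Sym2 V → ℝ := fun e =>
    if h : ∃ l, l < k ∧ e = s(x l, x (l + 1)) then y (h.choose + 1) - y h.choose else 0
  have hξ : ∀ l < k, ξ s(x l, x (l + 1)) = y (l + 1) - y l := by
    intro l hl
    have h : ∃ l', l' < k ∧ s(x l, x (l + 1)) = s(x l', x (l' + 1)) := ⟨l, hl, rfl⟩
    have e1 : ξ s(x l, x (l + 1)) = y (h.choose + 1) - y h.choose := dif_pos h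
    rw [e1]
    have h3 := edge_index K.inj hl.le hl h.choose_spec.1 h.choose_spec.2
    have : h.choose = l := by omega
    rw [this]
  have hstep : ∀ l, CC c x (l + 1) - CC c x l = c s(x l, x (l + 1)) := by
    intro l
    simp [CC, Finset.sum_range_succ]
  have hξ' : ∀ l < k, (fun e => c e - ξ e) s(x l, x (l + 1)) =
      (CC c x (l + 1) - y (l + 1)) - (CC c x l - y l) := by
    intro l hl
    simp only [hξ l hl, ← hstep]
    ring
  refine ⟨ξ, ?_, ?_, ?_⟩
  · intro e he
    obtain ⟨l, -, hl, rfl⟩ := mem_segL_iff.1 he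
    rw [hξ l hl, ← hstep]
    exact h0 l (l + 1) (by omega)
  · intro Q
    rw [CC_eq hξ]
    exact player_bound K h0 hξ h1 h2 h3 Q
  · intro Q
    rw [CC_eq (y := fun l => CC c x l - y l) hξ']
    refine player_bound K.swap (y := fun l => CC c x l - y l) ?_ hξ' h4 h5 h6 Q
    intro m n hmn
    have := h0 m n hmn
    constructor <;> linarith

end ShareSection

section FinalSection

open SimpleGraph

set_option linter.unusedSectionVars false

variable {G : SimpleGraph V} {c : Sym2 V → ℝ} {s₁ t₁ s₂ t₂ : V}

/-- Paths with all edges in an acyclic edge set are unique. -/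
lemma path_unique_F {F : Finset (Sym2 V)}
    (hF : (fromEdgeSet (↑F : Set (Sym2 V))).IsAcyclic) {u v : V} (p q : G.Walk u v)
    (hp : p.IsPath) (hq : q.IsPath) (hpF : ∀ e ∈ p.edges, e ∈ F) (hqF : ∀ e ∈ q.edges, e ∈ F) :
    p = q := by
  have hp' : ∀ e ∈ p.edges, e ∈ (fromEdgeSet (↑F : Set (Sym2 V))).edgeSet := by
    intro e he
    rw [edgeSet_fromEdgeSet]
    exact ⟨hpF e he, G.not_isDiag_of_mem_edgeSet (p.edges_subset_edgeSet he)⟩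
  have hq' : ∀ e ∈ q.edges, e ∈ (fromEdgeSet (↑F : Set (Sym2 V))).edgeSet := by
    intro e he
    rw [edgeSet_fromEdgeSet]
    exact ⟨hqF e he, G.not_isDiag_of_mem_edgeSet (q.edges_subset_edgeSet he)⟩
  have h := (hF.subsingleton_path u v).elim ⟨p.transfer _ hp', hp.transfer hp'⟩
    ⟨q.transfer _ hq', hq.transfer hq'⟩
  have h' := congrArg (fun r => r.1.support) h
  simp only [Walk.support_transfer] at h'
  exact Walk.ext_support h'

lemma sum_toFinset_le {c : Sym2 V → ℝ} (c0 : ∀ e, 0 ≤ c e) (L : List (Sym2 V)) :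
    ∑ e ∈ L.toFinset, c e ≤ (L.map c).sum := by
  induction L with
  | nil => simp
  | cons a L ih =>
    rw [List.toFinset_cons, List.map_cons, List.sum_cons]
    by_cases h : a ∈ L.toFinset
    · rw [Finset.insert_eq_of_mem h]
      linarith [c0 a]
    · rw [Finset.sum_insert h]
      linarith

/-- An optimal Steiner forest is at most as costly as any list of connecting edges. -/
lemma opt_list (c0 : ∀ e, 0 ≤ c e) {F : Finset (Sym2 V)}
    (hF : IsOptimalSteinerForest G s₁ t₁ s₂ t₂ c F) (L : List (Sym2 V))
    (hL : ∀ e ∈ L, e ∈ G.edgeSet) (h1 : RL L s₁ t₁) (h2 : RL L s₂ t₂) :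
    cost c F ≤ (L.map c).sum := by
  classical
  obtain ⟨T, hT, hTa, hTr⟩ := (fromEdgeSet {e | e ∈ L}).exists_isAcyclic_reachable_eq_le
  have hsub : ∀ e ∈ T.edgeSet, e ∈ L := by
    intro e he
    have := edgeSet_mono hT he
    rw [edgeSet_fromEdgeSet] at this
    exact this.1
  let F' : Finset (Sym2 V) := L.toFinset.filter (fun e => e ∈ T.edgeSet)
  have hF' : ∀ e, e ∈ F' ↔ e ∈ T.edgeSet := by
    intro e
    simp only [F', Finset.mem_filter, List.mem_toFinset]
    exact ⟨fun h => h.2, fun h => ⟨hsub e h, h⟩⟩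
  have hcoe : (↑F' : Set (Sym2 V)) = T.edgeSet := by
    ext e
    exact hF' e
  have hTG : ∀ e ∈ T.edgeSet, e ∈ G.edgeSet := fun e he => hL e (hsub e he)
  have hpath : ∀ u v, RL L u v → ∃ p : G.Walk u v, p.IsPath ∧ ∀ e ∈ p.edges, e ∈ F' := by
    intro u v h
    have h' : T.Reachable u v := by
      rw [hTr]
      exact h
    obtain ⟨p, hp⟩ := h'.exists_isPath
    have hpG : ∀ e ∈ p.edges, e ∈ G.edgeSet := fun e he => hTG e (p.edges_subset_edgeSet he)
    refine ⟨p.transfer G hpG, hp.transfer hpG, ?_⟩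
    intro e he
    rw [Walk.edges_transfer] at he
    exact (hF' e).2 (p.edges_subset_edgeSet he)
  have hle := hF.2 F' ⟨by rw [hcoe]; exact hTG, by rw [hcoe, fromEdgeSet_edgeSet]; exact hTa,
    hpath _ _ h1, hpath _ _ h2⟩
  refine hle.trans (le_trans ?_ (sum_toFinset_le c0 L))
  exact Finset.sum_le_sum_of_subset_of_nonneg (Finset.filter_subset _ _) fun e _ _ => c0 e

lemma sum_path (f : Sym2 V → ℝ) {u v : V} (p : G.Walk u v) (hp : p.IsPath) :
    ∑ e ∈ p.edges.toFinset, f e = wc f p :=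
  List.sum_toFinset f hp.isTrail.edges_nodup

lemma usedBy_zero (P₁ : Strat G s₁ t₁) (P₂ : Strat G s₂ t₂) (e : Sym2 V) :
    0 ∈ usedBy P₁ P₂ e ↔ e ∈ P₁.1.edges := by
  unfold usedBy
  split_ifs <;> simp_all

lemma usedBy_one (P₁ : Strat G s₁ t₁) (P₂ : Strat G s₂ t₂) (e : Sym2 V) :
    1 ∈ usedBy P₁ P₂ e ↔ e ∈ P₂.1.edges := by
  unfold usedBy
  split_ifs <;> simp_all

/-- Stable shares on the common edges give a separable protocol. -/
lemma enforce (c0 : ∀ e, 0 ≤ c e) (P₁ : Strat G s₁ t₁) (P₂ : Strat G s₂ t₂)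
    (L : List (Sym2 V)) (hL : ∀ e, e ∈ L ↔ e ∈ P₁.1.edges ∧ e ∈ P₂.1.edges)
    (ξ : Sym2 V → ℝ) (hξ : ∀ e ∈ L, 0 ≤ ξ e ∧ ξ e ≤ c e)
    (h1 : ∀ Q : G.Walk s₁ t₁, wc (dcost c ξ L) P₁.1 ≤ wc (dcost c ξ L) Q)
    (h2 : ∀ Q : G.Walk s₂ t₂, wc (dcost c (fun e => c e - ξ e) L) P₂.1 ≤
      wc (dcost c (fun e => c e - ξ e) L) Q) :
    ∃ Ξ : Protocol G s₁ t₁ s₂ t₂, IsSeparable c Ξ ∧ IsPNE Ξ P₁ P₂ := by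
  let a : Sym2 V → ℝ := fun e => if e ∈ L then ξ e else if e ∈ P₂.1.edges then c e else 0
  have ha : ∀ e, 0 ≤ a e ∧ a e ≤ c e := by
    intro e
    simp only [a]
    split_ifs with h h'
    · exact hξ e h
    · exact ⟨c0 e, le_rfl⟩
    · exact ⟨le_rfl, c0 e⟩
  let f : Finset (Fin 2) → Fin 2 → Sym2 V → ℝ := fun U i e =>
    if 0 ∈ U ∧ 1 ∈ U then (if i = 0 then a e else c e - a e) else if i ∈ U then c e else 0
  let Ξ : Protocol G s₁ t₁ s₂ t₂ := fun Q₁ Q₂ i e => f (usedBy Q₁ Q₂ e) i e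
  have hcost1 : ∀ Q₁, cost₁ Ξ Q₁ P₂ = wc (dcost c ξ L) Q₁.1 := by
    intro Q₁
    rw [← sum_path _ _ Q₁.2]
    refine Finset.sum_congr rfl fun e he => ?_
    rw [List.mem_toFinset] at he
    simp only [Ξ, f, a, usedBy_zero, usedBy_one, he, dcost, hL, true_and, if_true]
    by_cases e1 : e ∈ P₁.1.edges <;> by_cases e2 : e ∈ P₂.1.edges <;> simp [e1, e2]
  have hcost2 : ∀ Q₂, cost₂ Ξ P₁ Q₂ = wc (dcost c (fun e => c e - ξ e) L) Q₂.1 := by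
    intro Q₂
    rw [← sum_path _ _ Q₂.2]
    refine Finset.sum_congr rfl fun e he => ?_
    rw [List.mem_toFinset] at he
    simp only [Ξ, f, a, usedBy_zero, usedBy_one, he, dcost, hL, and_true, if_true]
    by_cases e1 : e ∈ P₁.1.edges <;> by_cases e2 : e ∈ P₂.1.edges <;> simp [e1, e2]
  have hpne : IsPNE Ξ P₁ P₂ := by
    refine ⟨fun Q₁ => ?_, fun Q₂ => ?_⟩
    · rw [hcost1, hcost1]
      exact h1 _
    · rw [hcost2, hcost2]
      exact h2 _
  refine ⟨Ξ, ⟨?_, ?_, ⟨P₁, P₂, hpne⟩, ?_⟩, hpne⟩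
  · intro Q₁ Q₂ i e
    simp only [Ξ, f]
    split_ifs
    · exact (ha e).1
    · linarith [(ha e).2]
    · exact c0 e
    · exact le_rfl
  · intro Q₁ Q₂ e hne
    by_cases e1 : e ∈ Q₁.1.edges <;> by_cases e2 : e ∈ Q₂.1.edges <;>
      simp [Ξ, f, usedBy, e1, e2] at hne ⊢
  · intro Q₁ Q₂ R₁ R₂ e h i
    simp only [Ξ, h]

/-- The first vertex of a walk in a set. -/
lemma first_hit (W : V → Prop) {s t : V} (p : G.Walk s t) (h : ∃ v ∈ p.support, W v) :
    ∃ (u : V) (A : G.Walk s u) (R : G.Walk u t), p = A.append R ∧ W u ∧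
      ∀ v ∈ A.support, W v → v = u := by
  induction p with
  | @nil s =>
    obtain ⟨v, hv, hW⟩ := h
    simp only [Walk.support_nil, List.mem_singleton] at hv
    subst hv
    exact ⟨v, Walk.nil, Walk.nil, rfl, hW, by simp⟩
  | @cons s s' t hs p ih =>
    by_cases hW : W s
    · exact ⟨s, Walk.nil, Walk.cons hs p, rfl, hW, by simp⟩
    · obtain ⟨v, hv, hv'⟩ := h
      rw [Walk.support_cons, List.mem_cons] at hv
      rcases hv with rfl | hv
      · exact absurd hv' hW
      obtain ⟨u, A, R, rfl, hu, hA⟩ := ih ⟨v, hv, hv'⟩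
      refine ⟨u, Walk.cons hs A, R, rfl, hu, ?_⟩
      intro w hw hw'
      rw [Walk.support_cons, List.mem_cons] at hw
      rcases hw with rfl | hw
      · exact absurd hw' hW
      · exact hA w hw hw'

lemma first_last (W : V → Prop) {s t : V} (p : G.Walk s t) (h : ∃ v ∈ p.support, W v) :
    ∃ (u v : V) (A : G.Walk s u) (S : G.Walk u v) (B : G.Walk v t), p = A.append (S.append B) ∧
      W u ∧ W v ∧ (∀ w ∈ A.support, W w → w = u) ∧ (∀ w ∈ B.support, W w → w = v) := by
  obtain ⟨u, A, R, rfl, hu, hA⟩ := first_hit W p h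
  obtain ⟨v, B, S, hR, hv, hB⟩ := first_hit W R.reverse ⟨u, by simp, hu⟩
  refine ⟨u, v, A, S.reverse, B.reverse, ?_, hu, hv, hA, by simpa using hB⟩
  rw [← Walk.reverse_append, ← hR, Walk.reverse_reverse]

lemma append_inter {u v w z : V} {p : G.Walk u v} {q : G.Walk v w} (h : (p.append q).IsPath)
    (h1 : z ∈ p.support) (h2 : z ∈ q.support) : z = v := by
  by_contra hne
  exact h.ne_of_mem_support_of_append hne h1 h2 rfl

/-- A path as a sequence of vertices. -/
lemma path_seq {u v : V} (S : G.Walk u v) (hS : S.IsPath) :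
    ∃ (k : ℕ) (x : ℕ → V), u = x 0 ∧ v = x k ∧ S.edges = segL x 0 k ∧
      (∀ n ≤ k, x n ∈ S.support) ∧ (∀ l < k, G.Adj (x l) (x (l + 1))) ∧
      (∀ m ≤ k, ∀ n ≤ k, x m = x n → m = n) := by
  refine ⟨S.length, S.getVert, by simp, by simp, ?_, ?_, ?_, ?_⟩
  · apply List.ext_getElem
    · simp [segL]
    · intro i h1 h2
      simp [segL, List.Ico, Walk.getElem_edges]
  · intro n hn
    exact S.getVert_mem_support n
  · intro l hl
    exact S.adj_getVert_succ hl
  · intro m hm n hn h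
    exact hS.getVert_injOn hm hn h

/-- Two walks which meet in at most one vertex have no common edge. -/
lemma edge_disjoint {u v w z o : V} (p : G.Walk u v) (q : G.Walk w z)
    (h : ∀ a ∈ p.support, a ∈ q.support → a = o) : ∀ e ∈ p.edges, e ∉ q.edges := by
  intro e he he'
  induction e using Sym2.ind with
  | _ a b =>
    have h1 := h a (p.fst_mem_support_of_mem_edges he) (q.fst_mem_support_of_mem_edges he')
    have h2 := h b (p.snd_mem_support_of_mem_edges he) (q.snd_mem_support_of_mem_edges he')
    exact (p.adj_of_mem_edges he).ne (h1.trans h2.symm)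

/-- Shares for two paths with a common segment. -/
lemma shares_common (c0 : ∀ e, 0 ≤ c e) (hG : ¬ HasK4Minor G) {u v : V}
    (A₁ : G.Walk s₁ u) (S : G.Walk u v) (B₁ : G.Walk v t₁) (A₂ : G.Walk s₂ u) (B₂ : G.Walk v t₂)
    (hP₁ : (A₁.append (S.append B₁)).IsPath) (hP₂ : (A₂.append (S.append B₂)).IsPath)
    (hA : ∀ w ∈ A₁.support, w ∈ (A₂.append (S.append B₂)).support → w = u)
    (hB : ∀ w ∈ B₁.support, w ∈ (A₂.append (S.append B₂)).support → w = v)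
    (F : Finset (Sym2 V)) (hF₁ : ∀ e ∈ (A₁.append (S.append B₁)).edges, e ∈ F)
    (hF₂ : ∀ e ∈ (A₂.append (S.append B₂)).edges, e ∈ F)
    (opt : ∀ L : List (Sym2 V), (∀ e ∈ L, e ∈ G.edgeSet) → RL L s₁ t₁ → RL L s₂ t₂ →
      cost c F ≤ (L.map c).sum) :
    ∃ (L : List (Sym2 V)) (ξ : Sym2 V → ℝ),
      (∀ e, e ∈ L ↔ e ∈ (A₁.append (S.append B₁)).edges ∧ e ∈ (A₂.append (S.append B₂)).edges) ∧
      (∀ e ∈ L, 0 ≤ ξ e ∧ ξ e ≤ c e) ∧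
      (∀ Q : G.Walk s₁ t₁, wc (dcost c ξ L) (A₁.append (S.append B₁)) ≤ wc (dcost c ξ L) Q) ∧
      (∀ Q : G.Walk s₂ t₂, wc (dcost c (fun e => c e - ξ e) L) (A₂.append (S.append B₂)) ≤
        wc (dcost c (fun e => c e - ξ e) L) Q) := by
  have hSB₁ := hP₁.of_append_right
  have hSB₂ := hP₂.of_append_right
  have hS := hSB₁.of_append_left
  have dA := edge_disjoint A₁ _ hA
  have dB := edge_disjoint B₁ _ hB
  -- disjointness of the edges of the different parts
  have dA₂ : ∀ e ∈ A₂.edges, e ∉ (S.append B₂).edges :=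
    edge_disjoint A₂ (S.append B₂) fun a h h' => append_inter hP₂ h h'
  have dB₂ : ∀ e ∈ S.edges, e ∉ B₂.edges :=
    edge_disjoint S B₂ fun a h h' => append_inter hSB₂ h h'
  simp only [Walk.edges_append, List.mem_append, not_or] at dA dB dA₂ hF₁ hF₂
  obtain ⟨k, x, rfl, rfl, hSe, hxS, adj, inj⟩ := path_seq S hS
  have hcomm : ∀ e, e ∈ segL x 0 k ↔ e ∈ (A₁.append (S.append B₁)).edges ∧
      e ∈ (A₂.append (S.append B₂)).edges := by
    intro e
    rw [← hSe]
    simp only [Walk.edges_append, List.mem_append]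
    constructor
    · intro h
      exact ⟨Or.inr (Or.inl h), Or.inr (Or.inl h)⟩
    · rintro ⟨h | h | h, h'⟩
      · have := dA e h
        tauto
      · exact h
      · have := dB e h
        tauto
  have wS : ∀ f : Sym2 V → ℝ, wc f S = CC f x k := by
    intro f
    rw [wc, hSe, sum_segL f x (Nat.zero_le k)]
    simp [CC]
  have hcost : wc c A₁ + wc c B₁ + (wc c A₂ + wc c B₂) + CC c x k ≤ cost c F := by
    have hnd1 := hP₁.isTrail.edges_nodup
    have hnd2 := hP₂.isTrail.edges_nodup
    have hnd : ((A₁.append (S.append B₁)).edges ++ (A₂.edges ++ B₂.edges)).Nodup := by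
      rw [List.nodup_append]
      refine ⟨hnd1, ?_, ?_⟩
      · simp only [Walk.edges_append, List.nodup_append, List.mem_append] at hnd2 ⊢
        exact ⟨hnd2.1, hnd2.2.1.2.1, fun a ha b hb => hnd2.2.2 a ha b (Or.inr hb)⟩
      · rintro e he e' he' rfl
        simp only [Walk.edges_append, List.mem_append] at he he'
        have := dA e
        have := dB e
        have := dA₂ e
        have := dB₂ e
        tauto
    have h1 := List.sum_toFinset c hnd
    have h2 : ∑ e ∈ ((A₁.append (S.append B₁)).edges ++ (A₂.edges ++ B₂.edges)).toFinset, c e ≤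
        cost c F := by
      refine Finset.sum_le_sum_of_subset_of_nonneg ?_ fun e _ _ => c0 e
      intro e he
      simp only [List.mem_toFinset, Walk.edges_append, List.mem_append] at he
      have := hF₁ e
      have := hF₂ e
      tauto
    rw [h1] at h2
    simp only [Walk.edges_append, List.map_append, List.sum_append] at h2
    change wc c A₁ + (wc c S + wc c B₁) + (wc c A₂ + wc c B₂) ≤ _ at h2
    rw [wS] at h2
    linarith
  let K : Core G c k x s₁ t₁ s₂ t₂ :=
    { c0 := c0
      nk4 := hG
      adj := adj
      inj := inj
      A₁ := A₁
      B₁ := B₁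
      A₂ := A₂
      B₂ := B₂
      hA₁ := by
        rintro w hw n hn rfl
        exact inj n hn 0 (Nat.zero_le k) (append_inter hP₁ hw
          (by rw [Walk.mem_support_append_iff]; exact Or.inl (hxS n hn)))
      hB₁ := by
        rintro w hw n hn rfl
        exact inj n hn k le_rfl (append_inter hSB₁ (hxS n hn) hw)
      hA₂ := by
        rintro w hw n hn rfl
        exact inj n hn 0 (Nat.zero_le k) (append_inter hP₂ hw
          (by rw [Walk.mem_support_append_iff]; exact Or.inl (hxS n hn)))
      hB₂ := by
        rintro w hw n hn rfl
        exact inj n hn k le_rfl (append_inter hSB₂ (hxS n hn) hw)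
      d₁ := by
        intro hk w hw hw'
        have h1 := append_inter hP₁ hw (by rw [Walk.mem_support_append_iff]; exact Or.inr hw')
        subst h1
        have := inj 0 (Nat.zero_le k) k le_rfl (append_inter hSB₁ S.start_mem_support hw')
        omega
      d₂ := by
        intro hk w hw hw'
        have h1 := append_inter hP₂ hw (by rw [Walk.mem_support_append_iff]; exact Or.inr hw')
        subst h1
        have := inj 0 (Nat.zero_le k) k le_rfl (append_inter hSB₂ S.start_mem_support hw')
        omega
      opt := fun L h h1 h2 => hcost.trans (opt L h h1 h2) }
  obtain ⟨ξ, hξ, hQ1, hQ2⟩ := core_shares K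
  have wd : ∀ (f : Sym2 V → ℝ) {a b : V} (p : G.Walk a b), (∀ e ∈ p.edges, e ∉ S.edges) →
      wc (dcost c f (segL x 0 k)) p = wc c p := by
    intro f a b p hp
    unfold wc
    congr 1
    apply List.map_congr_left
    intro e he
    unfold dcost
    rw [if_neg]
    rw [← hSe]
    exact hp e he
  have wdS : ∀ (f : Sym2 V → ℝ), wc (dcost c f (segL x 0 k)) S = CC f x k := by
    intro f
    rw [← wS]
    unfold wc
    congr 1
    apply List.map_congr_left
    intro e he
    unfold dcost
    rw [if_pos]
    rw [← hSe]
    exact he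
  refine ⟨segL x 0 k, ξ, hcomm, hξ, ?_, ?_⟩
  · intro Q
    rw [wc_append, wc_append, wdS, wd, wd]
    · have : CC ξ x k + (wc c A₁ + wc c B₁) ≤ _ := hQ1 Q
      linarith
    · exact fun e he => (dB e he).2.1
    · exact fun e he => (dA e he).2.1
  · intro Q
    rw [wc_append, wc_append, wdS, wd, wd]
    · have : CC (fun e => c e - ξ e) x k + (wc c A₂ + wc c B₂) ≤ _ := hQ2 Q
      linarith
    · exact fun e he he' => dB₂ e he' he
    · exact fun e he => (dA₂ e he).1

lemma dcost_nil (c ξ : Sym2 V → ℝ) : dcost c ξ [] = c := by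
  funext e
  simp [dcost]

/-- Stable shares for the two paths of an optimal Steiner forest. -/
lemma shares_exist (c0 : ∀ e, 0 ≤ c e) (hG : ¬ HasK4Minor G) {F : Finset (Sym2 V)}
    (hF : IsOptimalSteinerForest G s₁ t₁ s₂ t₂ c F) (P₁ : G.Walk s₁ t₁) (P₂ : G.Walk s₂ t₂)
    (hP₁ : P₁.IsPath) (hP₂ : P₂.IsPath) (hF₁ : ∀ e ∈ P₁.edges, e ∈ F)
    (hF₂ : ∀ e ∈ P₂.edges, e ∈ F) :
    ∃ (L : List (Sym2 V)) (ξ : Sym2 V → ℝ),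
      (∀ e, e ∈ L ↔ e ∈ P₁.edges ∧ e ∈ P₂.edges) ∧
      (∀ e ∈ L, 0 ≤ ξ e ∧ ξ e ≤ c e) ∧
      (∀ Q : G.Walk s₁ t₁, wc (dcost c ξ L) P₁ ≤ wc (dcost c ξ L) Q) ∧
      (∀ Q : G.Walk s₂ t₂, wc (dcost c (fun e => c e - ξ e) L) P₂ ≤
        wc (dcost c (fun e => c e - ξ e) L) Q) := by
  have hacyc := hF.1.2.1
  have opt := opt_list c0 hF
  by_cases hmeet : ∃ w ∈ P₁.support, w ∈ P₂.support
  · obtain ⟨u, v, A, S, B, rfl, hu, hv, hA, hB⟩ := first_last (fun w => w ∈ P₂.support) P₁ hmeet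
    have hS : S.IsPath := hP₁.of_append_right.of_append_left
    have hSF : ∀ e ∈ S.edges, e ∈ F := fun e he => hF₁ e (by simp [he])
    obtain ⟨A₂, R₂, rfl⟩ : ∃ (q : G.Walk s₂ u) (r : G.Walk u t₂), P₂ = q.append r :=
      ⟨P₂.takeUntil u hu, P₂.dropUntil u hu, (P₂.take_spec hu).symm⟩
    rcases (Walk.mem_support_append_iff _ _).1 hv with hv' | hv'
    · obtain ⟨C, D, rfl⟩ : ∃ (q : G.Walk s₂ v) (r : G.Walk v u), A₂ = q.append r :=
        ⟨A₂.takeUntil v hv', A₂.dropUntil v hv', (A₂.take_spec hv').symm⟩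
      have hD : D.reverse = S := by
        refine path_unique_F hacyc _ _ ?_ hS ?_ hSF
        · exact hP₂.of_append_left.of_append_right.reverse
        · intro e he
          exact hF₂ e (by simp at he; simp [he])
      have hD' : D = S.reverse := by rw [← hD, Walk.reverse_reverse]
      subst hD'
      have hrev : ((C.append S.reverse).append R₂).reverse =
          R₂.reverse.append (S.append C.reverse) := by
        simp [Walk.reverse_append]
      obtain ⟨L, ξ, h1, h2, h3, h4⟩ := shares_common c0 hG A S B R₂.reverse C.reverse hP₁
        (by rw [← hrev]; exact hP₂.reverse)
        (by rw [← hrev]; simpa only [Walk.support_reverse, List.mem_reverse] using hA)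
        (by rw [← hrev]; simpa only [Walk.support_reverse, List.mem_reverse] using hB) F hF₁
        (by rw [← hrev]; simpa only [Walk.edges_reverse, List.mem_reverse] using hF₂)
        (fun L h h1 h2 => opt L h h1 h2.symm)
      rw [← hrev] at h1 h4
      refine ⟨L, ξ, ?_, h2, h3, ?_⟩
      · simpa only [Walk.edges_reverse, List.mem_reverse] using h1
      · intro Q
        have := h4 Q.reverse
        rwa [wc_reverse, wc_reverse] at this
    · obtain ⟨C, D, rfl⟩ : ∃ (q : G.Walk u v) (r : G.Walk v t₂), R₂ = q.append r :=
        ⟨R₂.takeUntil v hv', R₂.dropUntil v hv', (R₂.take_spec hv').symm⟩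
      obtain rfl : C = S := by
        refine path_unique_F hacyc _ _ ?_ hS ?_ hSF
        · exact hP₂.of_append_right.of_append_left
        · intro e he
          exact hF₂ e (by simp [he])
      exact shares_common c0 hG A C B A₂ D hP₁ hP₂ hA hB F hF₁ hF₂ opt
  · push Not at hmeet
    have hdis : ∀ e ∈ P₁.edges, e ∉ P₂.edges :=
      edge_disjoint (o := s₁) P₁ P₂ fun a h h' => absurd h' (hmeet a h)
    have hcost : wc c P₁ + wc c P₂ ≤ cost c F := by
      have hnd : (P₁.edges ++ P₂.edges).Nodup := by
        rw [List.nodup_append]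
        refine ⟨hP₁.isTrail.edges_nodup, hP₂.isTrail.edges_nodup, ?_⟩
        rintro e he e' he' rfl
        exact hdis e he he'
      have h1 := List.sum_toFinset c hnd
      have h2 : ∑ e ∈ (P₁.edges ++ P₂.edges).toFinset, c e ≤ cost c F := by
        refine Finset.sum_le_sum_of_subset_of_nonneg ?_ fun e _ _ => c0 e
        intro e he
        simp only [List.mem_toFinset, List.mem_append] at he
        exact he.elim (hF₁ e) (hF₂ e)
      rw [h1] at h2
      simp only [List.map_append, List.sum_append] at h2
      exact h2
    have hQ : ∀ (Q₁ : G.Walk s₁ t₁) (Q₂ : G.Walk s₂ t₂), cost c F ≤ wc c Q₁ + wc c Q₂ := by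
      intro Q₁ Q₂
      have h := opt (Q₁.edges ++ Q₂.edges) ?_ (RL_of_walk Q₁ (by intro e he; simp [he]))
        (RL_of_walk Q₂ (by intro e he; simp [he]))
      · simp only [List.map_append, List.sum_append] at h
        exact h
      · intro e he
        rw [List.mem_append] at he
        exact he.elim (fun h => Q₁.edges_subset_edgeSet h) (fun h => Q₂.edges_subset_edgeSet h)
    refine ⟨[], fun _ => 0, ?_, ?_, ?_, ?_⟩
    · intro e
      simpa using hdis e
    · simp
    · intro Q
      rw [dcost_nil]
      linarith [hQ Q P₂]
    · intro Q
      rw [dcost_nil]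
      linarith [hQ P₁ Q]

end FinalSection

/-- Every generalized series-parallel graph (equivalently,
every `K₄`-minor-free graph) is strongly efficient for every placement of the
terminal pairs: for every nonnegative cost function, every optimal Steiner
forest of the induced two-player network design game is enforceable. -/
theorem gsp_strongly_efficient [Fintype V] (G : SimpleGraph V)
    (hGSP : ¬ HasK4Minor G) (s₁ t₁ s₂ t₂ : V) :
    StronglyEfficient G s₁ t₁ s₂ t₂ := by
  intro c c0 F hF
  obtain ⟨hFG, hacyc, ⟨P₁, hP₁, hF₁⟩, ⟨P₂, hP₂, hF₂⟩⟩ := hF.1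
  obtain ⟨L, ξ, h1, h2, h3, h4⟩ := shares_exist c0 hGSP hF P₁ P₂ hP₁ hP₂ hF₁ hF₂
  refine ⟨⟨P₁, hP₁⟩, ⟨P₂, hP₂⟩, hF₁, hF₂, ?_, ?_, ?_⟩
  · intro Q hQ
    exact Subtype.ext (path_unique_F hacyc _ _ Q.2 hP₁ hQ hF₁)
  · intro Q hQ
    exact Subtype.ext (path_unique_F hacyc _ _ Q.2 hP₂ hQ hF₂)
  · exact enforce c0 ⟨P₁, hP₁⟩ ⟨P₂, hP₂⟩ L h1 ξ h2 h3 h4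

end NDG
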